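/- arXiv:1712.08956 — 3 statements merged into one kernel-verified Lean document; each statement's English description precedes it below -/
import Mathlib

section
/- Let γ ∈ (0,1), A > 0, p < 1, and u₀ > 0. Then the continuous solution u of u(t) = u₀ + (A/Γ(γ)) ∫₀ᵗ (t−s)^(γ−1) u(s)^p ds with u(0) = u₀ exists globally on [0,∞), and there exist constants c₁ > 0 and c₂ > 0 such that c₁ t^(γ/(1−p)) ≤ u(t) ≤ c₂ t^(γ/(1−p)) for all t ≥ 1. -/
open MeasureTheory Set Filter

/-- The singular kernel `s ↦ (t - s) ^ (γ - 1)` is integrable on `[0, t]`. -/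
theorem intervalIntegrable_sub_rpow {γ : ℝ} (hγ : 0 < γ) (t : ℝ) :
    IntervalIntegrable (fun s => (t - s) ^ (γ - 1)) volume 0 t := by
  have h := (intervalIntegral.intervalIntegrable_rpow' (a := 0) (b := t)
    (r := γ - 1) (by linarith)).comp_sub_left t
  simpa using h.symm

theorem intervalIntegrable_sub_rpow_mul {γ : ℝ} (hγ : 0 < γ) {t : ℝ} (ht : 0 ≤ t) {g : ℝ → ℝ}
    (hg : ContinuousOn g (Icc 0 t)) :
    IntervalIntegrable (fun s => (t - s) ^ (γ - 1) * g s) volume 0 t :=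
  (intervalIntegrable_sub_rpow hγ t).mul_continuousOn (by rwa [uIcc_of_le ht])

theorem integral_sub_rpow {γ : ℝ} (hγ : 0 < γ) (t : ℝ) :
    ∫ s in (0:ℝ)..t, (t - s) ^ (γ - 1) = t ^ γ / γ := by
  rw [intervalIntegral.integral_comp_sub_left (fun x => x ^ (γ - 1)) t,
    integral_rpow (Or.inl (by linarith))]
  simp [Real.zero_rpow hγ.ne']

/-- Rescaling of the fractional integral to the unit interval. -/
theorem integral_sub_rpow_mul_eq {γ : ℝ} (hγ : 0 < γ) {t : ℝ} (ht : 0 ≤ t) (g : ℝ → ℝ) :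
    ∫ s in (0:ℝ)..t, (t - s) ^ (γ - 1) * g s =
      t ^ γ * ∫ σ in (0:ℝ)..1, (1 - σ) ^ (γ - 1) * g (t * σ) := by
  rcases ht.eq_or_lt with rfl | ht
  · simp [Real.zero_rpow hγ.ne']
  have h := intervalIntegral.integral_comp_mul_left (a := 0) (b := 1)
    (fun s => (t - s) ^ (γ - 1) * g s) ht.ne'
  simp only [mul_zero, mul_one, smul_eq_mul] at h
  rw [eq_inv_mul_iff_mul_eq₀ ht.ne'] at h
  rw [← h, ← intervalIntegral.integral_const_mul, ← intervalIntegral.integral_const_mul]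
  refine intervalIntegral.integral_congr fun σ hσ => ?_
  rw [uIcc_of_le zero_le_one] at hσ
  have h1 : t - t * σ = t * (1 - σ) := by ring
  have h2 : t ^ γ = t * t ^ (γ - 1) := by
    rw [Real.rpow_sub_one ht.ne']; field_simp
  rw [h1, Real.mul_rpow ht.le (by linarith [hσ.2]), h2]
  ring

theorem continuous_integral_one_sub_rpow_mul {γ : ℝ} (hγ : 0 < γ) {g : ℝ → ℝ}
    (hg : Continuous g) :
    Continuous fun t : ℝ => ∫ σ in (0:ℝ)..1, (1 - σ) ^ (γ - 1) * g (t * σ) := by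
  refine continuous_iff_continuousAt.2 fun t₀ => ?_
  obtain ⟨C, hC⟩ := (isCompact_Icc (a := -(|t₀| + 1)) (b := |t₀| + 1)).exists_bound_of_continuousOn
    hg.continuousOn
  have hint := intervalIntegrable_sub_rpow hγ 1
  refine intervalIntegral.continuousAt_of_dominated_interval
    (bound := fun σ => (1 - σ) ^ (γ - 1) * C) ?_ ?_ (hint.mul_const C) ?_
  · refine Eventually.of_forall fun t => ?_
    have := hint.mul_continuousOn (g := fun σ => g (t * σ)) (by fun_prop)
    exact (intervalIntegrable_iff.1 this).aestronglyMeasurable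
  · have : ∀ᶠ t in nhds t₀, t ∈ Metric.ball t₀ 1 := Metric.ball_mem_nhds _ one_pos
    filter_upwards [this] with t ht
    refine Eventually.of_forall fun σ hσ => ?_
    rw [uIoc_of_le zero_le_one] at hσ
    have hk : 0 ≤ (1 - σ) ^ (γ - 1) := Real.rpow_nonneg (by linarith [hσ.2]) _
    rw [norm_mul, Real.norm_of_nonneg hk]
    refine mul_le_mul_of_nonneg_left (hC _ (abs_le.1 ?_)) hk
    rw [Metric.mem_ball, Real.dist_eq] at ht
    have h1 : |t| ≤ |t₀| + 1 := by
      have := abs_sub_abs_le_abs_sub t t₀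
      linarith
    rw [abs_mul, abs_of_pos hσ.1]
    nlinarith [abs_nonneg t, hσ.2, hσ.1]
  · refine Eventually.of_forall fun σ _ => ?_
    have : Continuous fun t : ℝ => (1 - σ) ^ (γ - 1) * g (t * σ) := by fun_prop
    exact this.continuousAt

/-- The fractional integral of a function of exponential growth has the same exponential growth,
with a constant that decays as the growth rate increases. -/
theorem abs_integral_one_sub_rpow_mul_le {γ l M : ℝ} (hγ : 0 < γ) (hl : 0 < l) (hM : 0 ≤ M)
    {h : ℝ → ℝ} (hb : ∀ s, |h s| ≤ M * Real.exp (l * |s|)) (t : ℝ) :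
    |t| ^ γ * |∫ σ in (0:ℝ)..1, (1 - σ) ^ (γ - 1) * h (t * σ)| ≤
      Real.exp (l * |t|) * (M * ((1 / l) ^ γ * Real.Gamma γ)) := by
  have hint := intervalIntegrable_sub_rpow hγ 1
  have step1 : |∫ σ in (0:ℝ)..1, (1 - σ) ^ (γ - 1) * h (t * σ)| ≤
      ∫ σ in (0:ℝ)..1, (1 - σ) ^ (γ - 1) * (M * Real.exp (l * (|t| * σ))) := by
    have hint' := hint.mul_continuousOn (g := fun σ => M * Real.exp (l * (|t| * σ)))
      (by fun_prop)
    rw [← Real.norm_eq_abs]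
    refine intervalIntegral.norm_integral_le_of_norm_le zero_le_one
      (Eventually.of_forall fun σ hσ => ?_) hint'
    have hk : 0 ≤ (1 - σ) ^ (γ - 1) := Real.rpow_nonneg (by linarith [hσ.2]) _
    rw [norm_mul, Real.norm_of_nonneg hk]
    refine mul_le_mul_of_nonneg_left ?_ hk
    have := hb (t * σ)
    rwa [abs_mul, abs_of_pos hσ.1] at this
  calc |t| ^ γ * |∫ σ in (0:ℝ)..1, (1 - σ) ^ (γ - 1) * h (t * σ)|
      ≤ |t| ^ γ * ∫ σ in (0:ℝ)..1, (1 - σ) ^ (γ - 1) * (M * Real.exp (l * (|t| * σ))) := by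
        gcongr
    _ = ∫ s in (0:ℝ)..|t|, (|t| - s) ^ (γ - 1) * (M * Real.exp (l * s)) :=
        (integral_sub_rpow_mul_eq hγ (abs_nonneg t) fun s => M * Real.exp (l * s)).symm
    _ = ∫ s in (0:ℝ)..|t|, Real.exp (l * |t|) * M *
          ((|t| - s) ^ (γ - 1) * Real.exp (-(l * (|t| - s)))) := by
        congr 1 with s
        have : Real.exp (l * s) = Real.exp (l * |t|) * Real.exp (-(l * (|t| - s))) := by
          rw [← Real.exp_add]; ring_nf
        rw [this]; ring
    _ = Real.exp (l * |t|) * M *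
          ∫ r in (0:ℝ)..|t|, r ^ (γ - 1) * Real.exp (-(l * r)) := by
        rw [intervalIntegral.integral_const_mul,
          intervalIntegral.integral_comp_sub_left
            (fun r => r ^ (γ - 1) * Real.exp (-(l * r))) |t|]
        simp
    _ ≤ Real.exp (l * |t|) * M * ((1 / l) ^ γ * Real.Gamma γ) := by
        gcongr
        rw [← Real.integral_rpow_mul_exp_neg_mul_Ioi hγ hl,
          intervalIntegral.integral_of_le (abs_nonneg t)]
        refine setIntegral_mono_set ?_ ?_ (Ioc_subset_Ioi_self).eventuallyLE
        · have := integrableOn_rpow_mul_exp_neg_mul_rpow (p := 1) (s := γ - 1) (b := l)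
            (by linarith) one_pos hl
          simpa using this
        · refine (ae_restrict_iff' measurableSet_Ioi).2 (Eventually.of_forall fun r hr => ?_)
          exact mul_nonneg (Real.rpow_nonneg (le_of_lt hr) _) (Real.exp_pos _).le
    _ = _ := by ring

/-- Global existence for the Volterra equation with weakly singular kernel and Lipschitz
nonlinearity, written on the whole line via the rescaled fractional integral. -/
theorem exists_continuous_solution_of_lipschitzWith {γ C u₀ : ℝ} (hγ : 0 < γ) (hC : 0 ≤ C)
    {K : NNReal} {f : ℝ → ℝ} (hf : LipschitzWith K f) :
    ∃ u : ℝ → ℝ, Continuous u ∧ ∀ t, u t =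
      u₀ + C * (|t| ^ γ * ∫ σ in (0:ℝ)..1, (1 - σ) ^ (γ - 1) * f (u (t * σ))) := by
  have hG := Real.Gamma_pos_of_pos hγ
  set D : ℝ := 2 * (C * K * Real.Gamma γ) + 1 with hD
  have hCK : 0 ≤ C * K * Real.Gamma γ := by positivity
  have hD0 : 0 < D := by linarith
  set l : ℝ := D ^ (1 / γ) with hl_def
  have hl : 0 < l := by positivity
  have hlγ : (1 / l) ^ γ = 1 / D := by
    rw [Real.div_rpow zero_le_one hl.le, Real.one_rpow, hl_def, ← Real.rpow_mul hD0.le]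
    simp [hγ.ne']
  have hsmall : C * (K * ((1 / l) ^ γ * Real.Gamma γ)) ≤ 1 / 2 := by
    rw [hlγ]
    have : C * (K * (1 / D * Real.Gamma γ)) = (C * K * Real.Gamma γ) / D := by ring
    rw [this, div_le_iff₀ hD0]
    linarith
  let U : (BoundedContinuousFunction ℝ ℝ) → ℝ → ℝ := fun v s => Real.exp (l * |s|) * v s
  have hUc : ∀ v, Continuous (U v) := fun v => by
    have := v.continuous
    fun_prop
  have hUdist : ∀ v w s, |U v s - U w s| ≤ dist v w * Real.exp (l * |s|) := fun v w s => by
    have h1 : U v s - U w s = Real.exp (l * |s|) * (v s - w s) := by simp only [U]; ring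
    rw [h1, abs_mul, abs_of_pos (Real.exp_pos _), mul_comm]
    gcongr
    exact BoundedContinuousFunction.dist_coe_le_dist (f := v) (g := w) s
  have hfU : ∀ v s, |f (U v s)| ≤ (|f 0| + K * ‖v‖) * Real.exp (l * |s|) := fun v s => by
    have h1 := hf.dist_le_mul (U v s) 0
    rw [Real.dist_eq, Real.dist_eq, sub_zero] at h1
    have h2 : |U v s| ≤ ‖v‖ * Real.exp (l * |s|) := by
      simp only [U]
      rw [abs_mul, abs_of_pos (Real.exp_pos _), mul_comm]
      gcongr
      exact v.norm_coe_le_norm s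
    have h3 : |f (U v s)| ≤ |f 0| + |f (U v s) - f 0| := by
      have := abs_sub_abs_le_abs_sub (f (U v s)) (f 0)
      linarith
    have h4 : 1 ≤ Real.exp (l * |s|) := Real.one_le_exp (by positivity)
    have h5 : (K:ℝ) * |U v s| ≤ K * (‖v‖ * Real.exp (l * |s|)) := by gcongr
    nlinarith [abs_nonneg (f 0)]
  let N : (BoundedContinuousFunction ℝ ℝ) → ℝ → ℝ := fun v t =>
    ∫ σ in (0:ℝ)..1, (1 - σ) ^ (γ - 1) * f (U v (t * σ))
  have hNc : ∀ v, Continuous (N v) := fun v =>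
    continuous_integral_one_sub_rpow_mul hγ (hf.continuous.comp (hUc v))
  let Φ : (BoundedContinuousFunction ℝ ℝ) → BoundedContinuousFunction ℝ ℝ := fun v =>
    BoundedContinuousFunction.ofNormedAddCommGroup
      (fun t => Real.exp (-(l * |t|)) * (u₀ + C * (|t| ^ γ * N v t)))
      (by
        have := hNc v
        have h2 : Continuous fun t : ℝ => |t| ^ γ :=
          continuous_abs.rpow_const fun _ => Or.inr hγ.le
        fun_prop)
      (|u₀| + C * ((|f 0| + K * ‖v‖) * ((1 / l) ^ γ * Real.Gamma γ)))
      (fun t => by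
        have h1 := abs_integral_one_sub_rpow_mul_le hγ hl (by positivity) (hfU v) t
        have h2 : 1 ≤ Real.exp (l * |t|) := Real.one_le_exp (by positivity)
        have h3 : |u₀ + C * (|t| ^ γ * N v t)| ≤ |u₀| + C * (|t| ^ γ * |N v t|) := by
          refine (abs_add_le _ _).trans_eq ?_
          rw [abs_mul, abs_mul, abs_of_nonneg hC, abs_of_nonneg (by positivity : 0 ≤ |t| ^ γ)]
        rw [norm_mul, Real.norm_of_nonneg (Real.exp_pos _).le, Real.norm_eq_abs, Real.exp_neg,
          inv_mul_le_iff₀ (Real.exp_pos _)]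
        have h4 := mul_le_mul_of_nonneg_left h1 hC
        nlinarith [abs_nonneg u₀])
  have hΦ : ContractingWith (1 / 2 : NNReal) Φ := by
    refine ⟨by rw [← NNReal.coe_lt_coe]; norm_num, LipschitzWith.of_dist_le_mul fun v w => ?_⟩
    refine (BoundedContinuousFunction.dist_le (by positivity)).2 fun t => ?_
    have hd : ∀ s, |f (U v s) - f (U w s)| ≤ (K * dist v w) * Real.exp (l * |s|) := fun s => by
      refine (hf.dist_le_mul (U v s) (U w s)).trans ?_
      rw [Real.dist_eq, mul_assoc]
      gcongr
      exact hUdist v w s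
    have h1 := abs_integral_one_sub_rpow_mul_le hγ hl (by positivity) hd t
    have hsub : N v t - N w t =
        ∫ σ in (0:ℝ)..1, (1 - σ) ^ (γ - 1) * (f (U v (t * σ)) - f (U w (t * σ))) := by
      have hi : ∀ v, IntervalIntegrable (fun σ => (1 - σ) ^ (γ - 1) * f (U v (t * σ)))
          volume 0 1 := fun v => by
        have h1 := hUc v
        have h2 := hf.continuous
        exact (intervalIntegrable_sub_rpow hγ 1).mul_continuousOn (by fun_prop)
      simp only [N]
      rw [← intervalIntegral.integral_sub (hi v) (hi w)]
      congr 1 with σ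
      ring
    rw [← hsub] at h1
    have h2 : Φ v t - Φ w t = Real.exp (-(l * |t|)) * (C * (|t| ^ γ * (N v t - N w t))) := by
      simp only [Φ, BoundedContinuousFunction.coe_ofNormedAddCommGroup]
      ring
    rw [Real.dist_eq, h2, abs_mul, abs_of_pos (Real.exp_pos _), abs_mul, abs_mul,
      abs_of_nonneg hC, abs_of_nonneg (by positivity : 0 ≤ |t| ^ γ), Real.exp_neg,
      inv_mul_le_iff₀ (Real.exp_pos _)]
    calc C * (|t| ^ γ * |N v t - N w t|)
        ≤ C * (Real.exp (l * |t|) * ((K * dist v w) * ((1 / l) ^ γ * Real.Gamma γ))) := by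
          gcongr
      _ = Real.exp (l * |t|) * ((C * (K * ((1 / l) ^ γ * Real.Gamma γ))) * dist v w) := by ring
      _ ≤ Real.exp (l * |t|) * ((1 / 2) * dist v w) := by gcongr
      _ = _ := by simp
  obtain ⟨v, hv⟩ : ∃ v, Φ v = v := ⟨_, hΦ.fixedPoint_isFixedPt⟩
  refine ⟨U v, hUc v, fun t => ?_⟩
  have h1 : v t = Real.exp (-(l * |t|)) * (u₀ + C * (|t| ^ γ * N v t)) :=
    (congrArg (fun w : BoundedContinuousFunction ℝ ℝ => w t) hv).symm
  change Real.exp (l * |t|) * v t = u₀ + C * (|t| ^ γ * N v t)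
  rw [h1, ← mul_assoc, ← Real.exp_add]
  simp

/-- A power with exponent at most one is Lipschitz away from the origin. -/
theorem exists_lipschitzWith_max_rpow {p u₀ : ℝ} (hp : p < 1) (hu₀ : 0 < u₀) :
    ∃ K : NNReal, LipschitzWith K fun x : ℝ => max x u₀ ^ p := by
  have h0 : 0 ≤ |p| * u₀ ^ (p - 1) := by positivity
  refine ⟨(|p| * u₀ ^ (p - 1)).toNNReal, ?_⟩
  have h : LipschitzOnWith (|p| * u₀ ^ (p - 1)).toNNReal (fun x : ℝ => x ^ p) (Ici u₀) := by
    refine (convex_Ici u₀).lipschitzOnWith_of_nnnorm_hasDerivWithin_le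
      (f' := fun x => p * x ^ (p - 1)) (fun x hx => ?_) fun x hx => ?_
    · exact (Real.hasDerivAt_rpow_const
        (Or.inl (hu₀.trans_le hx).ne')).hasDerivWithinAt
    · rw [← NNReal.coe_le_coe, Real.coe_toNNReal _ h0, coe_nnnorm, norm_mul, Real.norm_eq_abs,
        Real.norm_of_nonneg (Real.rpow_nonneg (hu₀.le.trans hx) _)]
      exact mul_le_mul_of_nonneg_left
        (Real.rpow_le_rpow_of_nonpos hu₀ hx (by linarith)) (abs_nonneg p)
  refine LipschitzWith.of_dist_le_mul fun x y => ?_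
  refine (h.dist_le_mul _ (le_max_right x u₀) _ (le_max_right y u₀)).trans ?_
  gcongr
  simpa using (LipschitzWith.id.max_const u₀).dist_le_mul x y

/-- Global existence for the power-law fractional equation. -/
theorem exists_solution_of_rpow {γ C p u₀ : ℝ} (hγ : 0 < γ) (hC : 0 ≤ C) (hp : p < 1)
    (hu₀ : 0 < u₀) :
    ∃ u : ℝ → ℝ, Continuous u ∧ (∀ t, u₀ ≤ u t) ∧ ∀ t, 0 ≤ t →
      u t = u₀ + C * ∫ s in (0:ℝ)..t, (t - s) ^ (γ - 1) * u s ^ p := by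
  obtain ⟨K, hK⟩ := exists_lipschitzWith_max_rpow hp hu₀
  obtain ⟨u, huc, hu⟩ := exists_continuous_solution_of_lipschitzWith (u₀ := u₀) hγ hC hK
  have hge : ∀ t, u₀ ≤ u t := fun t => by
    rw [hu t]
    have : 0 ≤ ∫ σ in (0:ℝ)..1, (1 - σ) ^ (γ - 1) * max (u (t * σ)) u₀ ^ p := by
      refine intervalIntegral.integral_nonneg zero_le_one fun σ hσ => ?_
      exact mul_nonneg (Real.rpow_nonneg (by linarith [hσ.2]) _)
        (Real.rpow_nonneg (hu₀.le.trans (le_max_right _ _)) _)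
    have : 0 ≤ C * (|t| ^ γ * ∫ σ in (0:ℝ)..1,
      (1 - σ) ^ (γ - 1) * max (u (t * σ)) u₀ ^ p) := by positivity
    linarith
  refine ⟨u, huc, hge, fun t ht => ?_⟩
  rw [integral_sub_rpow_mul_eq hγ ht fun s => u s ^ p]
  have := hu t
  simp only [max_eq_left (hge _)] at this
  rwa [abs_of_nonneg ht] at this

theorem intervalIntegrable_one_sub_rpow_mul_rpow {γ β : ℝ} (hγ : 0 < γ) (hβ : -1 < β) :
    IntervalIntegrable (fun σ : ℝ => (1 - σ) ^ (γ - 1) * σ ^ β) volume 0 1 := by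
  have h := (Complex.betaIntegral_convergent (u := ((β + 1 : ℝ) : ℂ)) (v := (γ : ℂ))
    (by simp; linarith) (by simpa using hγ)).norm
  rw [intervalIntegrable_iff_integrableOn_Ioo_of_le zero_le_one] at h ⊢
  refine h.congr_fun (fun σ hσ => ?_) measurableSet_Ioo
  have h1 : (1 - (σ : ℂ)) = ((1 - σ : ℝ) : ℂ) := by push_cast; ring
  simp only [norm_mul]
  rw [h1, Complex.norm_cpow_eq_rpow_re_of_pos hσ.1,
    Complex.norm_cpow_eq_rpow_re_of_pos (by linarith [hσ.2]), mul_comm]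
  simp

theorem integral_one_sub_rpow_mul_rpow_pos {γ β : ℝ} (hγ : 0 < γ) (hβ : -1 < β) :
    0 < ∫ σ in (0:ℝ)..1, (1 - σ) ^ (γ - 1) * σ ^ β :=
  intervalIntegral.intervalIntegral_pos_of_pos_on
    (intervalIntegrable_one_sub_rpow_mul_rpow hγ hβ)
    (fun _ hσ => mul_pos (Real.rpow_pos_of_pos (by linarith [hσ.2]) _)
      (Real.rpow_pos_of_pos hσ.1 _)) one_pos

/-- Tonelli bound for the time integral of a fractional integral. -/
theorem integral_integral_sub_rpow_mul_le {γ t : ℝ} (hγ : 0 < γ) (ht : 0 ≤ t) {g : ℝ → ℝ}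
    (hg : Continuous g) (hg0 : ∀ s, 0 ≤ g s) :
    ∫ x in (0:ℝ)..t, ∫ s in (0:ℝ)..x, (x - s) ^ (γ - 1) * g s ≤
      t ^ γ / γ * ∫ s in (0:ℝ)..t, g s := by
  set F : ℝ → ℝ := (Ioc 0 t).indicator g with hF
  set k : ℝ → ℝ := (Ioc 0 t).indicator fun x => x ^ (γ - 1) with hk
  have hFi : Integrable F :=
    (integrable_indicator_iff measurableSet_Ioc).2 (hg.integrableOn_Ioc)
  have hki : Integrable k := by
    refine (integrable_indicator_iff measurableSet_Ioc).2 ?_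
    exact (intervalIntegrable_iff_integrableOn_Ioc_of_le ht).1
      (intervalIntegral.intervalIntegrable_rpow' (by linarith))
  have hF0 : ∀ s, 0 ≤ F s := fun s => indicator_nonneg (fun x _ => hg0 x) s
  have hk0 : ∀ s, 0 ≤ k s := fun s =>
    indicator_nonneg (fun x hx => Real.rpow_nonneg hx.1.le _) s
  let L := ContinuousLinearMap.mul ℝ ℝ
  have hconv := integral_posConvolution hFi.integrableOn hki.integrableOn L
    (μ := volume) (ν := volume) (f := F) (g := k)
  have hint : IntegrableOn (fun x : ℝ => ∫ s in (0:ℝ)..x, L (F s) (k (x - s))) (Ioi 0) :=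
    (integrable_indicator_iff measurableSet_Ioi).1
      (integrable_posConvolution hFi.integrableOn hki.integrableOn L)
  have hIF : ∫ x in Ioi (0:ℝ), F x = ∫ s in (0:ℝ)..t, g s := by
    rw [setIntegral_indicator measurableSet_Ioc, inter_eq_self_of_subset_right Ioc_subset_Ioi_self,
      intervalIntegral.integral_of_le ht]
  have hIk : ∫ x in Ioi (0:ℝ), k x = t ^ γ / γ := by
    rw [setIntegral_indicator measurableSet_Ioc, inter_eq_self_of_subset_right Ioc_subset_Ioi_self,
      ← intervalIntegral.integral_of_le ht, integral_rpow (Or.inl (by linarith))]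
    simp [Real.zero_rpow hγ.ne']
  rw [hIF, hIk] at hconv
  calc ∫ x in (0:ℝ)..t, ∫ s in (0:ℝ)..x, (x - s) ^ (γ - 1) * g s
      = ∫ x in Ioc 0 t, ∫ s in (0:ℝ)..x, L (F s) (k (x - s)) := by
        rw [intervalIntegral.integral_of_le ht]
        refine setIntegral_congr_fun measurableSet_Ioc fun x hx => ?_
        refine intervalIntegral.integral_congr_Ioo_of_le hx.1.le fun s hs => ?_
        have h1 : F s = g s := indicator_of_mem (show s ∈ Ioc 0 t from ⟨hs.1, hs.2.le.trans hx.2⟩) _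
        have h2 : k (x - s) = (x - s) ^ (γ - 1) :=
          indicator_of_mem
            (show x - s ∈ Ioc 0 t from ⟨by linarith [hs.2], by linarith [hs.1, hx.2]⟩) _
        simp [L, h1, h2, mul_comm]
    _ ≤ ∫ x in Ioi 0, ∫ s in (0:ℝ)..x, L (F s) (k (x - s)) := by
        refine setIntegral_mono_set hint ?_ (Ioc_subset_Ioi_self).eventuallyLE
        refine (ae_restrict_iff' measurableSet_Ioi).2 (Eventually.of_forall fun x hx => ?_)
        exact intervalIntegral.integral_nonneg (le_of_lt hx) fun s _ =>
          mul_nonneg (hF0 s) (hk0 _)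
    _ = _ := by
        rw [hconv]
        simp [L, mul_comm]

/-- The Bernoulli inequality for nonpositive real exponents. -/
theorem one_add_mul_sub_one_le_rpow {p x : ℝ} (hp : p ≤ 0) (hx : 0 < x) :
    1 + p * (x - 1) ≤ x ^ p := by
  rw [Real.rpow_def_of_pos hx]
  have h1 := Real.add_one_le_exp (Real.log x * p)
  have h2 := Real.log_le_sub_one_of_pos hx
  nlinarith

/-- A convex power lies above its tangent lines. -/
theorem tangent_le_rpow {p m x : ℝ} (hp : p ≤ 0) (hm : 0 < m) (hx : 0 < x) :
    (1 - p) * m ^ p + p * m ^ (p - 1) * x ≤ x ^ p := by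
  have h := one_add_mul_sub_one_le_rpow hp (div_pos hx hm)
  rw [Real.div_rpow hx.le hm.le, le_div_iff₀ (by positivity)] at h
  refine le_trans (le_of_eq ?_) h
  rw [Real.rpow_sub_one hm.ne']
  field_simp
  ring

/-- The fractional integral reproduces the self-similar profile. -/
theorem integral_one_sub_rpow_mul_selfSimilar {γ α p c t : ℝ} (hc : 0 ≤ c) (ht : 0 ≤ t) :
    ∫ σ in (0:ℝ)..1, (1 - σ) ^ (γ - 1) * (c * (t * σ) ^ α) ^ p =
      c ^ p * t ^ (α * p) * ∫ σ in (0:ℝ)..1, (1 - σ) ^ (γ - 1) * σ ^ (α * p) := by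
  rw [← intervalIntegral.integral_const_mul]
  refine intervalIntegral.integral_congr fun σ hσ => ?_
  rw [uIcc_of_le zero_le_one] at hσ
  have hσ0 := hσ.1
  rw [Real.mul_rpow hc (by positivity), ← Real.rpow_mul (by positivity),
    Real.mul_rpow ht hσ0]
  ring

section Growth

variable {γ C p u₀ α : ℝ} {u : ℝ → ℝ}

/-- Upper growth bound for a nondecreasing nonlinearity. -/
theorem exists_upper_bound_of_nonneg (hγ : 0 < γ) (hC : 0 < C) (hp0 : 0 ≤ p) (hp : p < 1)
    (hu₀ : 0 < u₀) (hα : α = γ / (1 - p)) (huc : Continuous u) (hge : ∀ t, u₀ ≤ u t)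
    (hu : ∀ t, 0 ≤ t → u t = u₀ + C * ∫ s in (0:ℝ)..t, (t - s) ^ (γ - 1) * u s ^ p) :
    ∃ c > 0, ∀ t, 1 ≤ t → u t ≤ c * t ^ α := by
  have hpos : ∀ t, 0 < u t := fun t => hu₀.trans_le (hge t)
  have h1p : 0 < 1 - p := by linarith
  set D : ℝ := u₀ ^ (1 - p) + C / γ with hD
  have hD0 : 0 < D := by positivity
  refine ⟨D ^ (1 / (1 - p)), by positivity, fun t ht => ?_⟩
  have ht0 : 0 < t := by linarith
  obtain ⟨τ, hτ, hmax⟩ := (isCompact_Icc (a := (0:ℝ)) (b := t)).exists_isMaxOn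
    ⟨0, le_refl _, ht0.le⟩ huc.continuousOn
  set M := u τ with hM
  have hM0 : 0 < M := hpos τ
  have hucp : Continuous fun s => u s ^ p := huc.rpow_const fun s => Or.inl (hpos s).ne'
  have hI : ∫ s in (0:ℝ)..τ, (τ - s) ^ (γ - 1) * u s ^ p ≤ τ ^ γ / γ * M ^ p := by
    rw [← integral_sub_rpow hγ τ, ← intervalIntegral.integral_mul_const]
    refine intervalIntegral.integral_mono_on hτ.1
      (intervalIntegrable_sub_rpow_mul hγ hτ.1 hucp.continuousOn)
      ((intervalIntegrable_sub_rpow hγ τ).mul_const _) fun s hs => ?_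
    refine mul_le_mul_of_nonneg_left ?_ (Real.rpow_nonneg (by linarith [hs.2]) _)
    exact Real.rpow_le_rpow (hpos s).le (hmax ⟨hs.1, hs.2.trans hτ.2⟩) hp0
  have hτt : τ ^ γ ≤ t ^ γ := Real.rpow_le_rpow hτ.1 hτ.2 hγ.le
  have ht1 : 1 ≤ t ^ γ := Real.one_le_rpow ht hγ.le
  have hM1 : M ≤ D * t ^ γ * M ^ p := by
    have e1 : M ≤ u₀ + C * (t ^ γ / γ * M ^ p) := by
      have h : τ ^ γ / γ * M ^ p ≤ t ^ γ / γ * M ^ p := by gcongr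
      have := mul_le_mul_of_nonneg_left (hI.trans h) hC.le
      linarith [hu τ hτ.1]
    have e2 : u₀ ≤ u₀ ^ (1 - p) * t ^ γ * M ^ p := by
      calc u₀ = u₀ ^ (1 - p) * 1 * u₀ ^ p := by
            rw [mul_one, ← Real.rpow_add hu₀]; simp
        _ ≤ _ := by
            gcongr
            exact hge τ
    calc M ≤ u₀ ^ (1 - p) * t ^ γ * M ^ p + C * (t ^ γ / γ * M ^ p) := by linarith
      _ = _ := by rw [hD]; ring
  have hM2 : M ^ (1 - p) ≤ D * t ^ γ := by
    rw [Real.rpow_sub hM0, Real.rpow_one, div_le_iff₀ (by positivity)]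
    exact hM1
  have hM3 := Real.rpow_le_rpow (by positivity) hM2 (by positivity : 0 ≤ 1 / (1 - p))
  rw [← Real.rpow_mul hM0.le, mul_one_div_cancel h1p.ne', Real.rpow_one,
    Real.mul_rpow hD0.le (by positivity), ← Real.rpow_mul ht0.le, mul_one_div, ← hα] at hM3
  exact (hmax ⟨ht0.le, le_refl t⟩).trans hM3

/-- Lower growth bound for a nondecreasing nonlinearity, by comparison with the self-similar
solution. -/
theorem exists_lower_bound_of_nonneg (hγ : 0 < γ) (hC : 0 < C) (hp0 : 0 ≤ p) (hp : p < 1)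
    (hu₀ : 0 < u₀) (hα : α = γ / (1 - p)) (huc : Continuous u) (hge : ∀ t, u₀ ≤ u t)
    (hu : ∀ t, 0 ≤ t → u t = u₀ + C * ∫ s in (0:ℝ)..t, (t - s) ^ (γ - 1) * u s ^ p) :
    ∃ c > 0, ∀ t, 1 ≤ t → c * t ^ α ≤ u t := by
  have hpos : ∀ t, 0 < u t := fun t => hu₀.trans_le (hge t)
  have h1p : 0 < 1 - p := by linarith
  have hα0 : 0 < α := by rw [hα]; positivity
  have hαp : γ + α * p = α := by rw [hα]; field_simp; ring
  have hβ : -1 < α * p := by nlinarith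
  set B := ∫ σ in (0:ℝ)..1, (1 - σ) ^ (γ - 1) * σ ^ (α * p) with hB
  have hB0 : 0 < B := integral_one_sub_rpow_mul_rpow_pos hγ hβ
  set c := (C * B) ^ (1 / (1 - p)) with hc
  have hc0 : 0 < c := by positivity
  have hcB : C * B * c ^ p = c := by
    have : c ^ (1 - p) = C * B := by
      rw [hc, ← Real.rpow_mul (by positivity), one_div_mul_cancel h1p.ne', Real.rpow_one]
    rw [← this, ← Real.rpow_add hc0]
    simp
  refine ⟨c, hc0, fun t ht => ?_⟩
  by_contra! hlt
  have ht0 : 0 ≤ t := by linarith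
  have hcont : Continuous fun s : ℝ => c * s ^ α :=
    continuous_const.mul (Real.continuous_rpow_const hα0.le)
  have hcompact : IsCompact (Icc 0 t ∩ {s | u s ≤ c * s ^ α}) :=
    isCompact_Icc.inter_right (isClosed_le huc hcont)
  obtain ⟨τ, ⟨hτ, hτu⟩, hmin⟩ := hcompact.exists_isLeast ⟨t, ⟨ht0, le_refl t⟩, hlt.le⟩
  have hbefore : ∀ s, 0 ≤ s → s < τ → c * s ^ α ≤ u s := fun s hs hsτ => by
    by_contra! h
    exact absurd (hmin ⟨⟨hs, hsτ.le.trans hτ.2⟩, h.le⟩) (not_le.2 hsτ)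
  have hucp : Continuous fun s => u s ^ p := huc.rpow_const fun s => Or.inl (hpos s).ne'
  have hτ0 := hτ.1
  have hI : c ^ p * τ ^ (α * p) * B ≤
      ∫ σ in (0:ℝ)..1, (1 - σ) ^ (γ - 1) * u (τ * σ) ^ p := by
    rw [hB, ← integral_one_sub_rpow_mul_selfSimilar hc0.le hτ0]
    refine intervalIntegral.integral_mono_on_of_le_Ioo zero_le_one
      (intervalIntegrable_sub_rpow_mul hγ zero_le_one ?_)
      (intervalIntegrable_sub_rpow_mul hγ zero_le_one ?_) fun σ hσ => ?_
    · exact ((hcont.comp (continuous_const_mul τ)).rpow_const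
        fun _ => Or.inr hp0).continuousOn
    · exact (hucp.comp (continuous_const_mul τ)).continuousOn
    · have hσ0 := hσ.1
      refine mul_le_mul_of_nonneg_left ?_ (Real.rpow_nonneg (by linarith [hσ.2]) _)
      rcases hτ0.eq_or_lt with h0 | h0
      · rw [← h0]
        simpa [Real.zero_rpow hα0.ne'] using
          Real.rpow_le_rpow le_rfl (hpos 0).le hp0
      · exact Real.rpow_le_rpow (by positivity)
          (hbefore _ (by positivity) (by nlinarith [hσ.2])) hp0
  have hτeq := hu τ hτ0
  rw [integral_sub_rpow_mul_eq hγ hτ0 fun s => u s ^ p] at hτeq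
  have h1 : C * (τ ^ γ * (c ^ p * τ ^ (α * p) * B)) = c * τ ^ α := by
    rcases hτ0.eq_or_lt with h0 | h0
    · simp [← h0, Real.zero_rpow hα0.ne', Real.zero_rpow hγ.ne']
    · have : τ ^ α = τ ^ γ * τ ^ (α * p) := by rw [← Real.rpow_add h0, hαp]
      rw [this]
      linear_combination τ ^ γ * τ ^ (α * p) * hcB
  have h2 : C * (τ ^ γ * (c ^ p * τ ^ (α * p) * B)) ≤
      C * (τ ^ γ * ∫ σ in (0:ℝ)..1, (1 - σ) ^ (γ - 1) * u (τ * σ) ^ p) := by gcongr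
  have h3 : u τ ≤ c * τ ^ α := hτu
  linarith

/-- Lower growth bound for a decreasing nonlinearity. -/
theorem exists_lower_bound_of_neg (hγ : 0 < γ) (hγ1 : γ < 1) (hC : 0 < C) (hp : p < 0)
    (hu₀ : 0 < u₀) (hα : α = γ / (1 - p)) (huc : Continuous u) (hge : ∀ t, u₀ ≤ u t)
    (hu : ∀ t, 0 ≤ t → u t = u₀ + C * ∫ s in (0:ℝ)..t, (t - s) ^ (γ - 1) * u s ^ p) :
    ∃ c > 0, ∀ t, 1 ≤ t → c * t ^ α ≤ u t := by
  have hpos : ∀ t, 0 < u t := fun t => hu₀.trans_le (hge t)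
  have h1p : 0 < 1 - p := by linarith
  have hα0 : 0 < α := by rw [hα]; positivity
  have hαp : γ + α * p = α := by rw [hα]; field_simp; ring
  have hucp : Continuous fun s => u s ^ p := huc.rpow_const fun s => Or.inl (hpos s).ne'
  set q : ℝ := -p * u₀ ^ (p - 1) * (C / γ) with hq
  have hq0 : 0 < q := by
    have : 0 < -p := by linarith
    positivity
  refine ⟨C * u₀ ^ p / (1 + q), by positivity, fun t ht => ?_⟩
  have ht0 : 0 < t := by linarith
  set G := ∫ s in (0:ℝ)..t, u s ^ p with hG
  set V := ∫ s in (0:ℝ)..t, u s with hV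
  set m := u₀ * t ^ α with hm
  have hm0 : 0 < m := by positivity
  have hum : u₀ ≤ m := le_mul_of_one_le_right hu₀.le (Real.one_le_rpow ht hα0.le)
  have hmp : m ^ p = u₀ ^ p * t ^ (α * p) := by
    rw [hm, Real.mul_rpow hu₀.le (by positivity), ← Real.rpow_mul ht0.le]
  have hmp1 : m ^ (p - 1) * t ^ γ = u₀ ^ (p - 1) := by
    rw [hm, Real.mul_rpow hu₀.le (by positivity), ← Real.rpow_mul ht0.le, mul_assoc,
      ← Real.rpow_add ht0]
    have : α * (p - 1) + γ = 0 := by linear_combination hαp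
    rw [this]
    simp
  have hVle : V ≤ u₀ * t + C * (t ^ γ / γ * G) := by
    have e1 : V - u₀ * t = C * ∫ x in (0:ℝ)..t, ∫ s in (0:ℝ)..x, (x - s) ^ (γ - 1) * u s ^ p := by
      rw [← intervalIntegral.integral_const_mul]
      have : V - u₀ * t = ∫ s in (0:ℝ)..t, (u s - u₀) := by
        rw [intervalIntegral.integral_sub (huc.intervalIntegrable _ _)
          intervalIntegrable_const]
        simp [hV, mul_comm]
      rw [this]
      refine intervalIntegral.integral_congr fun x hx => ?_
      rw [uIcc_of_le ht0.le] at hx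
      have := hu x hx.1
      linarith
    have e2 := mul_le_mul_of_nonneg_left (integral_integral_sub_rpow_mul_le hγ ht0.le hucp
      fun s => (Real.rpow_pos_of_pos (hpos s) p).le) hC.le
    linarith
  have hGge : (1 - p) * m ^ p * t + p * m ^ (p - 1) * V ≤ G := by
    have e1 : (1 - p) * m ^ p * t + p * m ^ (p - 1) * V =
        ∫ s in (0:ℝ)..t, ((1 - p) * m ^ p + p * m ^ (p - 1) * u s) := by
      rw [intervalIntegral.integral_add intervalIntegrable_const
        ((huc.intervalIntegrable _ _).const_mul _), intervalIntegral.integral_const,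
        intervalIntegral.integral_const_mul, smul_eq_mul, sub_zero, mul_comm t]
    rw [e1]
    refine intervalIntegral.integral_mono_on ht0.le ?_ (hucp.intervalIntegrable _ _)
      fun s _ => tangent_le_rpow hp.le hm0 (hpos s)
    exact (by fun_prop : Continuous fun s => (1 - p) * m ^ p + p * m ^ (p - 1) * u s)
      |>.intervalIntegrable _ _
  have hGle : m ^ p * t ≤ (1 + q) * G := by
    have hmm : m ^ (p - 1) * m = m ^ p := by
      rw [Real.rpow_sub_one hm0.ne']; field_simp
    have hk : 0 ≤ -p * m ^ (p - 1) := by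
      have : 0 < -p := by linarith
      positivity
    have f1 := mul_le_mul_of_nonneg_left hVle hk
    have f2 : -p * m ^ (p - 1) * (u₀ * t) ≤ -p * m ^ p * t := by
      rw [← hmm]
      have := mul_le_mul_of_nonneg_left (mul_le_mul_of_nonneg_right hum ht0.le) hk
      linarith
    have f3 : -p * m ^ (p - 1) * (C * (t ^ γ / γ * G)) = q * G := by
      rw [hq, ← hmp1]; ring
    linarith
  have hut : C * (t ^ (γ - 1) * G) ≤ u t := by
    have : t ^ (γ - 1) * G ≤ ∫ s in (0:ℝ)..t, (t - s) ^ (γ - 1) * u s ^ p := by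
      rw [hG, ← intervalIntegral.integral_const_mul]
      refine intervalIntegral.integral_mono_on_of_le_Ioo ht0.le
        ((hucp.intervalIntegrable _ _).const_mul _)
        (intervalIntegrable_sub_rpow_mul hγ ht0.le hucp.continuousOn) fun s hs => ?_
      refine mul_le_mul_of_nonneg_right ?_ (Real.rpow_pos_of_pos (hpos s) p).le
      exact Real.rpow_le_rpow_of_nonpos (by linarith [hs.2]) (by linarith [hs.1])
        (by linarith)
    have := mul_le_mul_of_nonneg_left this hC.le
    rw [hu t ht0.le]
    linarith
  refine le_trans ?_ hut
  have htα : t ^ α = t ^ (γ - 1) * (t ^ (α * p) * t) := by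
    rw [← Real.rpow_add_one ht0.ne', ← Real.rpow_add ht0]
    congr 1
    linear_combination -hαp
  calc C * u₀ ^ p / (1 + q) * t ^ α
      = C * (t ^ (γ - 1) * (m ^ p * t / (1 + q))) := by rw [htα, hmp]; ring
    _ ≤ C * (t ^ (γ - 1) * G) := by
        gcongr
        rw [div_le_iff₀ (by positivity)]
        linarith

/-- For a decreasing nonlinearity, a lower growth bound yields the matching upper bound. -/
theorem exists_upper_bound_of_neg (hγ : 0 < γ) (hγ1 : γ < 1) (hC : 0 < C) (hp : p < 0)
    (hu₀ : 0 < u₀) (hα : α = γ / (1 - p)) (huc : Continuous u) (hge : ∀ t, u₀ ≤ u t)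
    (hu : ∀ t, 0 ≤ t → u t = u₀ + C * ∫ s in (0:ℝ)..t, (t - s) ^ (γ - 1) * u s ^ p)
    (hlow : ∃ c > 0, ∀ t, 1 ≤ t → c * t ^ α ≤ u t) :
    ∃ c > 0, ∀ t, 1 ≤ t → u t ≤ c * t ^ α := by
  obtain ⟨c₁, hc₁, hlow⟩ := hlow
  have hpos : ∀ t, 0 < u t := fun t => hu₀.trans_le (hge t)
  have h1p : 0 < 1 - p := by linarith
  have hα0 : 0 < α := by rw [hα]; positivity
  have hαp : γ + α * p = α := by rw [hα]; field_simp; ring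
  have hβ : -1 < α * p := by linarith
  have hucp : Continuous fun s => u s ^ p := huc.rpow_const fun s => Or.inl (hpos s).ne'
  set c := min c₁ u₀ with hc
  have hc0 : 0 < c := lt_min hc₁ hu₀
  have hlow' : ∀ s, 0 ≤ s → c * s ^ α ≤ u s := fun s hs => by
    rcases le_total 1 s with h | h
    · exact (mul_le_mul_of_nonneg_right (min_le_left _ _) (by positivity)).trans (hlow s h)
    · have := Real.rpow_le_one hs h hα0.le
      exact ((mul_le_of_le_one_right hc0.le this).trans (min_le_right _ _)).trans (hge s)
  set B := ∫ σ in (0:ℝ)..1, (1 - σ) ^ (γ - 1) * σ ^ (α * p) with hB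
  have hB0 : 0 < B := integral_one_sub_rpow_mul_rpow_pos hγ hβ
  refine ⟨u₀ + C * c ^ p * B, by positivity, fun t ht => ?_⟩
  have ht0 : 0 < t := by linarith
  have hI : ∫ σ in (0:ℝ)..1, (1 - σ) ^ (γ - 1) * u (t * σ) ^ p ≤
      c ^ p * t ^ (α * p) * B := by
    rw [hB, ← intervalIntegral.integral_const_mul]
    refine intervalIntegral.integral_mono_on_of_le_Ioo zero_le_one
      (intervalIntegrable_sub_rpow_mul hγ zero_le_one
        (hucp.comp (continuous_const_mul t)).continuousOn)
      ((intervalIntegrable_one_sub_rpow_mul_rpow hγ hβ).const_mul _) fun σ hσ => ?_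
    have hσ0 := hσ.1
    have h1 : u (t * σ) ^ p ≤ (c * (t * σ) ^ α) ^ p :=
      Real.rpow_le_rpow_of_nonpos (by positivity) (hlow' _ (by positivity)) hp.le
    rw [Real.mul_rpow hc0.le (by positivity), ← Real.rpow_mul (by positivity),
      Real.mul_rpow ht0.le hσ0.le] at h1
    have h2 := mul_le_mul_of_nonneg_left h1
      (Real.rpow_nonneg (by linarith [hσ.2]) (γ - 1) : 0 ≤ (1 - σ) ^ (γ - 1))
    linarith
  have htα : t ^ α = t ^ γ * t ^ (α * p) := by rw [← Real.rpow_add ht0, hαp]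
  have h1 : u₀ ≤ u₀ * t ^ α := le_mul_of_one_le_right hu₀.le (Real.one_le_rpow ht hα0.le)
  rw [hu t ht0.le, integral_sub_rpow_mul_eq hγ ht0.le fun s => u s ^ p]
  calc u₀ + C * (t ^ γ * ∫ σ in (0:ℝ)..1, (1 - σ) ^ (γ - 1) * u (t * σ) ^ p)
      ≤ u₀ * t ^ α + C * (t ^ γ * (c ^ p * t ^ (α * p) * B)) := by gcongr
    _ = _ := by rw [htα]; ring

end Growth

/-- For `A > 0`, `p < 1`, the solution of `D_c^γ u = A u^p`, `u(0)=u₀>0`,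
exists globally and grows like `t^(γ/(1−p))`: there are `c₁, c₂ > 0` with
`c₁ t^(γ/(1−p)) ≤ u(t) ≤ c₂ t^(γ/(1−p))` for all `t ≥ 1`. -/
theorem fractional_ode_sublinear_growth
    (γ A p u₀ : ℝ) (hγ : γ ∈ Set.Ioo (0:ℝ) 1) (hA : 0 < A) (hp : p < 1) (hu₀ : 0 < u₀) :
    ∃ u : ℝ → ℝ, ContinuousOn u (Set.Ici 0) ∧ u 0 = u₀ ∧
      (∀ t : ℝ, 0 ≤ t → 0 < u t) ∧
      (∀ t : ℝ, 0 ≤ t →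
        u t = u₀ + (A / Real.Gamma γ) * ∫ s in (0:ℝ)..t, (t - s) ^ (γ - 1) * u s ^ p) ∧
      ∃ c₁ > (0:ℝ), ∃ c₂ > (0:ℝ), ∀ t : ℝ, 1 ≤ t →
        c₁ * t ^ (γ / (1 - p)) ≤ u t ∧ u t ≤ c₂ * t ^ (γ / (1 - p)) := by
  obtain ⟨hγ0, hγ1⟩ := hγ
  have hC : 0 < A / Real.Gamma γ := div_pos hA (Real.Gamma_pos_of_pos hγ0)
  obtain ⟨u, huc, hge, hu⟩ := exists_solution_of_rpow hγ0 hC.le hp hu₀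
  refine ⟨u, huc.continuousOn, by simpa using hu 0 le_rfl, fun t _ => hu₀.trans_le (hge t), hu, ?_⟩
  obtain ⟨⟨c₁, hc₁, h₁⟩, c₂, hc₂, h₂⟩ :
      (∃ c > 0, ∀ t, 1 ≤ t → c * t ^ (γ / (1 - p)) ≤ u t) ∧
        ∃ c > 0, ∀ t, 1 ≤ t → u t ≤ c * t ^ (γ / (1 - p)) := by
    rcases le_or_gt 0 p with hp0 | hp0
    · exact ⟨exists_lower_bound_of_nonneg hγ0 hC hp0 hp hu₀ rfl huc hge hu,
        exists_upper_bound_of_nonneg hγ0 hC hp0 hp hu₀ rfl huc hge hu⟩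
    · have hlow := exists_lower_bound_of_neg hγ0 hγ1 hC hp0 hu₀ rfl huc hge hu
      exact ⟨hlow, exists_upper_bound_of_neg hγ0 hγ1 hC hp0 hu₀ rfl huc hge hu hlow⟩
  exact ⟨c₁, hc₁, c₂, hc₂, fun t ht => ⟨h₁ t ht, h₂ t ht⟩⟩
end

section
/- Let γ ∈ (0,1), A < 0, p > 0, and u₀ > 0. Then the continuous solution u of u(t) = u₀ + (A/Γ(γ)) ∫₀ᵗ (t−s)^(γ−1) u(s)^p ds with u(0) = u₀ exists globally on [0,∞), remains strictly positive, and there exist constants c₁ > 0 and c₂ > 0 such that c₁ t^(−γ/p) ≤ u(t) ≤ c₂ t^(−γ/p) for all t ≥ 1. -/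
open MeasureTheory Set Filter

/-- The convolution of `g` with the kernel `x ^ (γ - 1)`, that is, the Riemann-Liouville integral
of order `γ` multiplied by `Γ(γ)`. -/
noncomputable def kernelConv (γ : ℝ) (g : ℝ → ℝ) (t : ℝ) : ℝ :=
  ∫ s in (0:ℝ)..t, (t - s) ^ (γ - 1) * g s

lemma intervalIntegrable_kernel {γ : ℝ} (hγ : 0 < γ) (t a b : ℝ) :
    IntervalIntegrable (fun s => (t - s) ^ (γ - 1)) volume a b := by
  have h := (intervalIntegral.intervalIntegrable_rpow' (a := t - a) (b := t - b)
    (r := γ - 1) (by linarith)).comp_sub_left t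
  simpa using h

lemma intervalIntegrable_kernel_mul {γ : ℝ} (hγ : 0 < γ) (t : ℝ) {a b : ℝ} {g : ℝ → ℝ}
    (hg : ContinuousOn g (uIcc a b)) :
    IntervalIntegrable (fun s => (t - s) ^ (γ - 1) * g s) volume a b :=
  (intervalIntegrable_kernel hγ t a b).mul_continuousOn hg

lemma integral_kernel {γ : ℝ} (hγ : 0 < γ) (a t : ℝ) :
    ∫ s in a..t, (t - s) ^ (γ - 1) = (t - a) ^ γ / γ := by
  rw [intervalIntegral.integral_comp_sub_left (fun x => x ^ (γ - 1)) t,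
    integral_rpow (Or.inl (by linarith))]
  simp [hγ.ne']

lemma kernelConv_eq_rpow_mul {γ : ℝ} (hγ : 0 < γ) (g : ℝ → ℝ) {t : ℝ} (ht : 0 ≤ t) :
    kernelConv γ g t = t ^ γ * ∫ x in (0:ℝ)..1, (1 - x) ^ (γ - 1) * g (t * x) := by
  rcases ht.eq_or_lt with rfl | ht
  · simp [kernelConv, Real.zero_rpow hγ.ne']
  have h := intervalIntegral.smul_integral_comp_mul_left (a := 0) (b := 1)
    (fun s => (t - s) ^ (γ - 1) * g s) t
  simp only [mul_zero, mul_one, smul_eq_mul] at h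
  rw [kernelConv, ← h]
  have hpow : t ^ γ = t * t ^ (γ - 1) := by
    rw [Real.rpow_sub_one ht.ne']; field_simp
  rw [hpow, mul_assoc, ← intervalIntegral.integral_const_mul (t ^ (γ - 1))]
  congr 1
  refine intervalIntegral.integral_congr fun x hx => ?_
  rw [uIcc_of_le zero_le_one] at hx
  have : t - t * x = t * (1 - x) := by ring
  simp only [this]
  rw [Real.mul_rpow ht.le (by linarith [hx.2])]
  ring

lemma continuousOn_kernelConv {γ B : ℝ} (hγ : 0 < γ) {g : ℝ → ℝ} (hg : Continuous g)
    (hB : ∀ x, |g x| ≤ B) : ContinuousOn (kernelConv γ g) (Ici 0) := by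
  have hcont : Continuous fun t : ℝ => ∫ x in (0:ℝ)..1, (1 - x) ^ (γ - 1) * g (t * x) := by
    refine intervalIntegral.continuous_of_dominated_interval
      (bound := fun x => |(1 - x) ^ (γ - 1)| * B) (fun t => ?_) (fun t => ?_) ?_ ?_
    · exact (intervalIntegrable_kernel_mul hγ 1 (a := 0) (b := 1)
        (g := fun x => g (t * x)) (by fun_prop)).def'.aestronglyMeasurable
    · refine Eventually.of_forall fun x _ => ?_
      rw [Real.norm_eq_abs, abs_mul]
      exact mul_le_mul_of_nonneg_left (hB _) (abs_nonneg _)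
    · exact (intervalIntegrable_kernel hγ 1 0 1).abs.mul_const B
    · exact Eventually.of_forall fun x _ => by fun_prop
  refine ContinuousOn.congr (f := fun t => t ^ γ *
    ∫ x in (0:ℝ)..1, (1 - x) ^ (γ - 1) * g (t * x)) ?_
    fun t ht => kernelConv_eq_rpow_mul hγ g ht
  exact ((Real.continuous_rpow_const hγ.le).mul hcont).continuousOn

lemma exists_abs_kernelConv_le_exp {γ η : ℝ} (hγ : 0 < γ) (hη : 0 < η) :
    ∃ K > 0, ∀ (g : ℝ → ℝ) (M t : ℝ), 0 ≤ t → 0 ≤ M → ContinuousOn g (Icc 0 t) →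
      (∀ s ∈ Icc 0 t, |g s| ≤ M * Real.exp (K * s)) →
      |kernelConv γ g t| ≤ η * M * Real.exp (K * t) := by
  have hΓ := Real.Gamma_pos_of_pos hγ
  set K : ℝ := (Real.Gamma γ / η) ^ (1 / γ) with hKdef
  have hK : 0 < K := Real.rpow_pos_of_pos (div_pos hΓ hη) _
  have hKint : (1 / K) ^ γ * Real.Gamma γ = η := by
    rw [Real.div_rpow zero_le_one hK.le, Real.one_rpow, hKdef,
      ← Real.rpow_mul (div_pos hΓ hη).le, one_div_mul_cancel hγ.ne', Real.rpow_one]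
    field_simp
  refine ⟨K, hK, fun g M t ht hM hg hbound => ?_⟩
  have hint : IntegrableOn (fun x : ℝ => x ^ (γ - 1) * Real.exp (-(K * x))) (Ioi 0) := by
    have := integrableOn_rpow_mul_exp_neg_mul_rpow (p := 1) (s := γ - 1) (b := K)
      (by linarith) one_pos hK
    simpa [neg_mul] using this
  have hker : ∫ s in (0:ℝ)..t, (t - s) ^ (γ - 1) * (M * Real.exp (K * s))
      ≤ η * M * Real.exp (K * t) := by
    have heq : ∫ s in (0:ℝ)..t, (t - s) ^ (γ - 1) * (M * Real.exp (K * s))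
        = M * Real.exp (K * t) * ∫ x in (0:ℝ)..t, x ^ (γ - 1) * Real.exp (-(K * x)) := by
      have := intervalIntegral.integral_comp_sub_left (a := 0) (b := t)
        (fun x => x ^ (γ - 1) * Real.exp (-(K * x))) t
      simp only [sub_zero, sub_self] at this
      rw [← this, ← intervalIntegral.integral_const_mul]
      refine intervalIntegral.integral_congr fun s _ => ?_
      have : Real.exp (K * s) = Real.exp (K * t) * Real.exp (-(K * (t - s))) := by
        rw [← Real.exp_add]; ring_nf
      simp only [this]; ring
    have hle : ∫ x in (0:ℝ)..t, x ^ (γ - 1) * Real.exp (-(K * x)) ≤ η := by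
      rw [← hKint, ← Real.integral_rpow_mul_exp_neg_mul_Ioi hγ hK,
        intervalIntegral.integral_of_le ht]
      refine setIntegral_mono_set hint ?_ Ioc_subset_Ioi_self.eventuallyLE
      refine (ae_restrict_mem measurableSet_Ioi).mono fun x hx => ?_
      exact mul_nonneg (Real.rpow_nonneg (le_of_lt hx) _) (Real.exp_pos _).le
    rw [heq]
    calc _ ≤ M * Real.exp (K * t) * η := by gcongr
      _ = _ := by ring
  refine le_trans ?_ hker
  rw [kernelConv, ← Real.norm_eq_abs]
  refine intervalIntegral.norm_integral_le_of_norm_le ht ?_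
    (intervalIntegrable_kernel_mul hγ t (by fun_prop))
  refine Eventually.of_forall fun s hs => ?_
  have h0 : 0 ≤ (t - s) ^ (γ - 1) := Real.rpow_nonneg (by linarith [hs.2]) _
  rw [Real.norm_eq_abs, abs_mul, abs_of_nonneg h0]
  exact mul_le_mul_of_nonneg_left (hbound s (Ioc_subset_Icc_self hs)) h0

lemma kernelConv_congr {γ t : ℝ} {f g : ℝ → ℝ} (ht : 0 ≤ t) (h : ∀ s ∈ Icc 0 t, f s = g s) :
    kernelConv γ f t = kernelConv γ g t := by
  refine intervalIntegral.integral_congr fun s hs => ?_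
  rw [uIcc_of_le ht] at hs
  simp only [h s hs]

lemma kernelConv_sub {γ t : ℝ} {f g : ℝ → ℝ} (hγ : 0 < γ) (ht : 0 ≤ t)
    (hf : ContinuousOn f (Icc 0 t)) (hg : ContinuousOn g (Icc 0 t)) :
    kernelConv γ f t - kernelConv γ g t = kernelConv γ (fun s => f s - g s) t := by
  rw [← uIcc_of_le ht] at hf hg
  rw [kernelConv, kernelConv, kernelConv, ← intervalIntegral.integral_sub
    (intervalIntegrable_kernel_mul hγ t hf) (intervalIntegrable_kernel_mul hγ t hg)]
  simp only [mul_sub]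

lemma exists_continuous_solution {γ c B : ℝ} (u₀ : ℝ) (hγ : 0 < γ) (hc : 0 < c) {L : NNReal}
    {F : ℝ → ℝ} (hF : LipschitzWith L F) (hB : ∀ x, |F x| ≤ B) :
    ∃ u : ℝ → ℝ, Continuous u ∧
      ∀ t, 0 ≤ t → u t = u₀ - c * kernelConv γ (fun s => F (u s)) t := by
  have hB0 : 0 ≤ B := (abs_nonneg _).trans (hB 0)
  have hL1 : (0:ℝ) < L + 1 := by positivity
  obtain ⟨K, hK, hest⟩ := exists_abs_kernelConv_le_exp hγ
    (η := 1 / (2 * c * (L + 1))) (by positivity)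
  have hFc := hF.continuous
  let g : BoundedContinuousFunction ℝ ℝ → ℝ → ℝ := fun v s => F (Real.exp (K * s) * v s)
  have hg : ∀ v, Continuous (g v) := fun v => by
    have := v.continuous
    fun_prop
  let φ : BoundedContinuousFunction ℝ ℝ → ℝ → ℝ := fun v t =>
    Real.exp (-(K * max t 0)) * (u₀ - c * kernelConv γ (g v) (max t 0))
  have hφc : ∀ v, Continuous (φ v) := fun v => by
    have h1 : Continuous fun t : ℝ => kernelConv γ (g v) (max t 0) :=
      (continuousOn_kernelConv hγ (hg v) (fun x => hB _)).comp_continuous (by fun_prop)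
        (fun t => le_max_right t 0)
    fun_prop
  have hφb : ∀ v t, ‖φ v t‖ ≤ |u₀| + c * (1 / (2 * c * (L + 1)) * B) := fun v t => by
    have hτ : 0 ≤ max t 0 := le_max_right t 0
    have h1 := hest (g v) B (max t 0) hτ hB0 (hg v).continuousOn (fun s hs =>
      (hB _).trans (le_mul_of_one_le_right hB0 (Real.one_le_exp (mul_nonneg hK.le hs.1))))
    have hE : Real.exp (-(K * max t 0)) ≤ 1 := by
      rw [Real.exp_le_one_iff]; nlinarith
    have hEE : Real.exp (-(K * max t 0)) * Real.exp (K * max t 0) = 1 := by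
      rw [← Real.exp_add]; simp
    have hEp := Real.exp_pos (-(K * max t 0))
    simp only [φ, Real.norm_eq_abs, abs_mul, abs_of_pos hEp]
    calc _ ≤ Real.exp (-(K * max t 0)) * (|u₀| + c * (1 / (2 * c * (L + 1)) * B *
            Real.exp (K * max t 0))) := by
          gcongr
          refine (abs_sub _ _).trans ?_
          rw [abs_mul, abs_of_pos hc]
          gcongr
      _ = Real.exp (-(K * max t 0)) * |u₀| + c * (1 / (2 * c * (L + 1)) * B) *
            (Real.exp (-(K * max t 0)) * Real.exp (K * max t 0)) := by ring
      _ ≤ _ := by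
          rw [hEE, mul_one]
          gcongr
          exact mul_le_of_le_one_left (abs_nonneg _) hE
  let Φ : BoundedContinuousFunction ℝ ℝ → BoundedContinuousFunction ℝ ℝ := fun v =>
    BoundedContinuousFunction.ofNormedAddCommGroup (φ v) (hφc v) _ (hφb v)
  have hΦ : ContractingWith (1 / 2) Φ := by
    refine ⟨by norm_num, LipschitzWith.of_dist_le_mul fun v w => ?_⟩
    refine (BoundedContinuousFunction.dist_le (by positivity)).2 fun t => ?_
    have hτ : 0 ≤ max t 0 := le_max_right t 0
    have h1 := hest (fun s => g v s - g w s) (L * dist v w) (max t 0) hτ (by positivity)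
      ((hg v).sub (hg w)).continuousOn (fun s _ => by
        have h2 := hF.dist_le_mul (Real.exp (K * s) * v s) (Real.exp (K * s) * w s)
        rw [Real.dist_eq, Real.dist_eq, ← mul_sub, abs_mul, abs_of_pos (Real.exp_pos _),
          ← Real.dist_eq (v s)] at h2
        refine h2.trans ?_
        have := BoundedContinuousFunction.dist_coe_le_dist (f := v) (g := w) s
        calc _ ≤ (L:ℝ) * (Real.exp (K * s) * dist v w) := by gcongr
          _ = _ := by ring)
    rw [← kernelConv_sub hγ hτ (hg v).continuousOn (hg w).continuousOn] at h1
    change dist (φ v t) (φ w t) ≤ _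
    have hEE : Real.exp (-(K * max t 0)) * Real.exp (K * max t 0) = 1 := by
      rw [← Real.exp_add]; simp
    have hEp := Real.exp_pos (-(K * max t 0))
    have heq : φ v t - φ w t = -(Real.exp (-(K * max t 0)) * c) *
        (kernelConv γ (g v) (max t 0) - kernelConv γ (g w) (max t 0)) := by
      simp only [φ]; ring
    rw [Real.dist_eq, heq, abs_mul, abs_neg, abs_of_pos (mul_pos hEp hc)]
    calc _ ≤ Real.exp (-(K * max t 0)) * c * (1 / (2 * c * (L + 1)) * (L * dist v w) *
            Real.exp (K * max t 0)) := by gcongr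
      _ = (L / (L + 1)) * (1 / 2 * dist v w) *
            (Real.exp (-(K * max t 0)) * Real.exp (K * max t 0)) := by field_simp
      _ ≤ 1 * (1 / 2 * dist v w) * 1 := by
          rw [hEE]
          gcongr
          rw [div_le_one hL1]; linarith
      _ = _ := by simp
  have hfix := hΦ.fixedPoint_isFixedPt
  set v := ContractingWith.fixedPoint Φ hΦ
  refine ⟨fun t => Real.exp (K * t) * v t, by have := v.continuous; fun_prop, fun t ht => ?_⟩
  have h1 : v t = φ v t := by
    conv_lhs => rw [← hfix]
    rfl
  have hEE : Real.exp (K * t) * Real.exp (-(K * t)) = 1 := by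
    rw [← Real.exp_add]; simp
  simp only [φ, max_eq_left ht] at h1
  change Real.exp (K * t) * v t = u₀ - c * kernelConv γ (g v) t
  rw [h1, ← mul_assoc, hEE, one_mul]

lemma solution_unique {γ c T u₀ a b : ℝ} (hγ : 0 < γ) (hc : 0 < c) {L : NNReal}
    {F : ℝ → ℝ} (hF : LipschitzOnWith L F (Icc a b)) {u v : ℝ → ℝ}
    (hu : ContinuousOn u (Icc 0 T)) (hv : ContinuousOn v (Icc 0 T))
    (hub : MapsTo u (Icc 0 T) (Icc a b)) (hvb : MapsTo v (Icc 0 T) (Icc a b))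
    (hu_eq : ∀ t ∈ Icc 0 T, u t = u₀ - c * kernelConv γ (fun s => F (u s)) t)
    (hv_eq : ∀ t ∈ Icc 0 T, v t = u₀ - c * kernelConv γ (fun s => F (v s)) t) :
    EqOn u v (Icc 0 T) := by
  intro t₀ ht₀
  have hL1 : (0:ℝ) < L + 1 := by positivity
  obtain ⟨K, hK, hest⟩ := exists_abs_kernelConv_le_exp hγ
    (η := 1 / (2 * c * (L + 1))) (by positivity)
  have hFu : ContinuousOn (fun s => F (u s)) (Icc 0 T) := hF.continuousOn.comp hu hub
  have hFv : ContinuousOn (fun s => F (v s)) (Icc 0 T) := hF.continuousOn.comp hv hvb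
  obtain ⟨t, ht, hmax⟩ := isCompact_Icc.exists_isMaxOn ⟨t₀, ht₀⟩
    (f := fun t => Real.exp (-(K * t)) * |u t - v t|) (by fun_prop)
  set M := Real.exp (-(K * t)) * |u t - v t| with hM
  have hexp : ∀ s : ℝ, Real.exp (K * s) * Real.exp (-(K * s)) = 1 := fun s => by
    rw [← Real.exp_add]; simp
  have hM0 : 0 ≤ M := by positivity
  have hle : ∀ s ∈ Icc 0 T, |u s - v s| ≤ M * Real.exp (K * s) := fun s hs => by
    have h1 : Real.exp (-(K * s)) * |u s - v s| ≤ M := hmax hs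
    calc |u s - v s| = Real.exp (-(K * s)) * |u s - v s| * Real.exp (K * s) := by
          linear_combination -|u s - v s| * hexp s
      _ ≤ _ := by gcongr
  have hsub : Icc 0 t ⊆ Icc 0 T := Icc_subset_Icc_right ht.2
  have h1 := hest (fun s => F (u s) - F (v s)) (L * M) t ht.1 (by positivity)
    ((hFu.mono hsub).sub (hFv.mono hsub)) (fun s hs => by
      have h2 := hF.dist_le_mul _ (hub (hsub hs)) _ (hvb (hsub hs))
      rw [Real.dist_eq, Real.dist_eq] at h2
      have := hle s (hsub hs)
      calc _ ≤ (L:ℝ) * (M * Real.exp (K * s)) := h2.trans (by gcongr)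
        _ = _ := by ring)
  rw [← kernelConv_sub hγ ht.1 (hFu.mono hsub) (hFv.mono hsub)] at h1
  have h3 : |u t - v t| = c * |kernelConv γ (fun s => F (u s)) t -
      kernelConv γ (fun s => F (v s)) t| := by
    rw [hu_eq t ht, hv_eq t ht, ← abs_of_pos hc, ← abs_mul, abs_of_pos hc, abs_sub_comm]
    congr 1; ring
  have h4 : M ≤ M / 2 := by
    calc M ≤ Real.exp (-(K * t)) * (c * (1 / (2 * c * (L + 1)) * (L * M) * Real.exp (K * t))) := by
          rw [h3] at hM
          calc M = _ := hM
            _ ≤ _ := by gcongr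
      _ = (L / (L + 1)) * (M / 2) * (Real.exp (K * t) * Real.exp (-(K * t))) := by field_simp
      _ ≤ 1 * (M / 2) * 1 := by
          rw [hexp]
          gcongr
          rw [div_le_one hL1]; linarith
      _ = _ := by ring
  have h5 := hle t₀ ht₀
  have h6 : M = 0 := by linarith
  rw [h6, zero_mul] at h5
  exact sub_eq_zero.1 (abs_nonpos_iff.1 h5)

lemma rpow_div_mul_rpow_le {γ s t x : ℝ} (hγ1 : γ ≤ 1) (hs : 0 < s) (hx : 0 ≤ x) (hst : s ≤ t) :
    (t / s) ^ (γ - 1) * (s + x) ^ (γ - 1) ≤ (t + x) ^ (γ - 1) := by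
  have ht : 0 < t := hs.trans_le hst
  rw [← Real.mul_rpow (by positivity) (by positivity)]
  refine Real.rpow_le_rpow_of_nonpos (by positivity) ?_ (by linarith)
  rw [div_mul_eq_mul_div, le_div_iff₀ hs]
  nlinarith

lemma le_rpow_div_mul_rpow {γ s t x : ℝ} (hγ1 : γ ≤ 1) (hx : 0 ≤ x) (hxs : x < s) (hst : s ≤ t) :
    (t - x) ^ (γ - 1) ≤ (t / s) ^ (γ - 1) * (s - x) ^ (γ - 1) := by
  have hs : 0 < s := hx.trans_lt hxs
  have ht : 0 < t := hs.trans_le hst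
  have hsx : 0 < s - x := by linarith
  rw [← Real.mul_rpow (by positivity) hsx.le]
  refine Real.rpow_le_rpow_of_nonpos (by positivity) ?_ (by linarith)
  rw [div_mul_eq_mul_div, div_le_iff₀ hs]
  nlinarith

/-- The memory estimate following from log-convexity of the kernel: the contribution of the past
`[0, s]` at time `t` is controlled by the value of the convolution at time `s`. -/
lemma kernelConv_le_of_le {γ s t M : ℝ} (hγ : 0 < γ) (hγ1 : γ ≤ 1) (hs : 0 < s) (hst : s ≤ t)
    {g : ℝ → ℝ} (hg : ContinuousOn g (Icc 0 t)) (h0 : ∀ r ∈ Icc 0 s, 0 ≤ g r)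
    (hM : ∀ r ∈ Icc s t, g r ≤ M) :
    kernelConv γ g t ≤ (t / s) ^ (γ - 1) * kernelConv γ g s + M * ((t - s) ^ γ / γ) := by
  have ht : 0 < t := hs.trans_le hst
  have hg1 : ContinuousOn g (uIcc 0 s) := by
    rw [uIcc_of_le hs.le]; exact hg.mono (Icc_subset_Icc_right hst)
  have hg2 : ContinuousOn g (uIcc s t) := by
    rw [uIcc_of_le hst]; exact hg.mono (Icc_subset_Icc_left hs.le)
  have i1 := intervalIntegrable_kernel_mul hγ t hg1
  have i2 := intervalIntegrable_kernel_mul hγ t hg2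
  rw [kernelConv, ← intervalIntegral.integral_add_adjacent_intervals i1 i2]
  refine add_le_add ?_ ?_
  · rw [kernelConv, ← intervalIntegral.integral_const_mul]
    refine intervalIntegral.integral_mono_on_of_le_Ioo hs.le i1
      ((intervalIntegrable_kernel_mul hγ s hg1).const_mul _) fun r hr => ?_
    rw [← mul_assoc]
    exact mul_le_mul_of_nonneg_right (le_rpow_div_mul_rpow hγ1 hr.1.le hr.2 hst)
      (h0 r (Ioo_subset_Icc_self hr))
  · rw [← integral_kernel hγ, ← intervalIntegral.integral_const_mul]
    refine intervalIntegral.integral_mono_on hst i2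
      ((intervalIntegrable_kernel hγ t s t).const_mul _) fun r hr => ?_
    rw [mul_comm M]
    exact mul_le_mul_of_nonneg_left (hM r hr) (Real.rpow_nonneg (by linarith [hr.2]) _)

/-- Positivity for linear-type Volterra equations whose forcing decays no faster than the
kernel. -/
lemma pos_of_eq_sub_kernelConv {γ c L : ℝ} (hγ : 0 < γ) (hγ1 : γ ≤ 1) (hc : 0 < c) (hL : 0 ≤ L)
    {w G H : ℝ → ℝ} (hwc : ContinuousOn w (Ici 0)) (hHc : ContinuousOn H (Ici 0))
    (hw : ∀ t, 0 ≤ t → w t = G t - c * kernelConv γ H t)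
    (hH : ∀ t, 0 ≤ t → 0 ≤ w t → 0 ≤ H t ∧ H t ≤ L * w t)
    (hG : ∀ s t, 0 < s → s ≤ t → (t / s) ^ (γ - 1) * G s ≤ G t)
    (h0 : 0 < w 0) {t : ℝ} (ht : 0 ≤ t) : 0 < w t := by
  have hzero : ∀ r, 0 ≤ r → w r ≤ 0 → ∃ x ∈ Icc 0 r, w x = 0 := fun r hr hwr =>
    intermediate_value_Icc' hr (hwc.mono Icc_subset_Ici_self) ⟨hwr, h0.le⟩
  by_contra! hwt
  obtain ⟨x₀, hx₀, hwx₀⟩ := hzero t ht hwt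
  set S : Set ℝ := Ici 0 ∩ w ⁻¹' {0}
  have hScl : IsClosed S := hwc.preimage_isClosed_of_isClosed isClosed_Ici isClosed_singleton
  have hSb : BddBelow S := ⟨0, fun x hx => hx.1⟩
  obtain ⟨ht0, hwt1'⟩ : sInf S ∈ S := hScl.csInf_mem ⟨x₀, hx₀.1, hwx₀⟩ hSb
  set t₁ := sInf S
  have hwt1 : w t₁ = 0 := hwt1'
  have hpos : ∀ r, 0 ≤ r → r < t₁ → 0 < w r := by
    intro r hr hrt
    by_contra! hwr
    obtain ⟨x, hx, hwx⟩ := hzero r hr hwr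
    have : t₁ ≤ x := csInf_le hSb ⟨hx.1, hwx⟩
    linarith [hx.2]
  have ht1 : 0 < t₁ := by
    rcases (show 0 ≤ t₁ from ht0).eq_or_lt with h | h
    · rw [← h] at hwt1; linarith
    · exact h
  set κ : ℝ := 2 ^ (γ - 1)
  have hκp : 0 < κ := Real.rpow_pos_of_pos two_pos _
  set a : ℝ := κ * γ / (2 * c * (L + 1)) with ha
  have hap : 0 < a := by positivity
  set δ : ℝ := a ^ γ⁻¹
  have hδp : 0 < δ := Real.rpow_pos_of_pos hap _
  have hδa : δ ^ γ = a := Real.rpow_inv_rpow hap.le hγ.ne'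
  set s₀ := max (t₁ / 2) (t₁ - δ)
  have hs₀l : t₁ / 2 ≤ s₀ := le_max_left _ _
  have hs₀r : t₁ - δ ≤ s₀ := le_max_right _ _
  have hs₀t : s₀ < t₁ := max_lt (by linarith) (by linarith)
  obtain ⟨s, hs, hmax⟩ := isCompact_Icc.exists_isMaxOn (nonempty_Icc.2 hs₀t.le)
    (hwc.mono fun x hx => (show (0:ℝ) ≤ x by linarith [hx.1] : x ∈ Ici (0:ℝ)))
  have hws : 0 < w s := (hpos s₀ (by linarith) hs₀t).trans_le (hmax (left_mem_Icc.2 hs₀t.le))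
  have hs0 : 0 < s := by linarith [hs.1]
  have hnn : ∀ r ∈ Icc 0 t₁, 0 ≤ w r := fun r hr => by
    rcases hr.2.eq_or_lt with h | h
    · rw [h, hwt1]
    · exact (hpos r hr.1 h).le
  have hconv := kernelConv_le_of_le hγ hγ1 hs0 hs.2 (M := L * w s)
    (hHc.mono Icc_subset_Ici_self)
    (fun r hr => (hH r hr.1 (hnn r ⟨hr.1, hr.2.trans hs.2⟩)).1)
    (fun r hr => ((hH r (hs0.le.trans hr.1) (hnn r ⟨hs0.le.trans hr.1, hr.2⟩)).2).trans
      (mul_le_mul_of_nonneg_left (hmax ⟨hs.1.trans hr.1, hr.2⟩) hL))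
  have e1 := hw t₁ ht1.le
  have e2 := hw s hs0.le
  have hGs := hG s t₁ hs0 hs.2
  have hκs : κ ≤ (t₁ / s) ^ (γ - 1) := by
    refine Real.rpow_le_rpow_of_nonpos (by positivity) ?_ (by linarith)
    rw [div_le_iff₀ hs0]; linarith [hs.1]
  have hδs : (t₁ - s) ^ γ ≤ a := by
    rw [← hδa]
    exact Real.rpow_le_rpow (by linarith [hs.2]) (by linarith [hs.1]) hγ.le
  have key : (t₁ / s) ^ (γ - 1) * w s ≤ c * (L * w s * ((t₁ - s) ^ γ / γ)) := by
    have h1 := mul_le_mul_of_nonneg_left hconv hc.le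
    have h2 : (t₁ / s) ^ (γ - 1) * w s = (t₁ / s) ^ (γ - 1) * G s -
        c * ((t₁ / s) ^ (γ - 1) * kernelConv γ H s) := by rw [e2]; ring
    rw [mul_add] at h1
    linarith
  have h1 : κ * w s ≤ κ * w s / 2 := by
    calc κ * w s ≤ (t₁ / s) ^ (γ - 1) * w s := by gcongr
      _ ≤ c * (L * w s * (a / γ)) := key.trans (by gcongr)
      _ = (L / (L + 1)) * (κ * w s / 2) := by rw [ha]; field_simp
      _ ≤ 1 * (κ * w s / 2) := by
        gcongr
        rw [div_le_one (by linarith)]; linarith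
      _ = _ := one_mul _
  have := mul_pos hκp hws
  linarith

lemma kernelConv_add_shift {γ h t : ℝ} (hγ : 0 < γ) {g : ℝ → ℝ} (hg : Continuous g) :
    kernelConv γ g (t + h) = (∫ r in (0:ℝ)..h, (t + h - r) ^ (γ - 1) * g r) +
      kernelConv γ (fun r => g (r + h)) t := by
  rw [kernelConv, ← intervalIntegral.integral_add_adjacent_intervals (b := h)
    (intervalIntegrable_kernel_mul hγ _ hg.continuousOn)
    (intervalIntegrable_kernel_mul hγ _ hg.continuousOn), kernelConv]
  have := intervalIntegral.integral_comp_add_right (a := 0) (b := t)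
    (fun r => (t + h - r) ^ (γ - 1) * g r) h
  rw [zero_add] at this
  rw [← this]
  simp only [add_sub_add_right_eq_sub]

lemma solution_antitoneOn {γ c u₀ : ℝ} (hγ : 0 < γ) (hγ1 : γ ≤ 1) (hc : 0 < c) {L : NNReal}
    {F : ℝ → ℝ} (hF : LipschitzWith L F) (hmono : Monotone F) (hpos : ∀ x, 0 < F x)
    {u : ℝ → ℝ} (huc : Continuous u)
    (hu : ∀ t, 0 ≤ t → u t = u₀ - c * kernelConv γ (fun s => F (u s)) t) :
    AntitoneOn u (Ici 0) := by
  intro t ht t' _ htt'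
  rcases htt'.eq_or_lt with rfl | hlt
  · rfl
  obtain ⟨h, hh, rfl⟩ : ∃ h > 0, t' = t + h := ⟨t' - t, by linarith, by ring⟩
  have hFu : Continuous fun s => F (u s) := hF.continuous.comp huc
  have hFuh : Continuous fun s => F (u (s + h)) := hFu.comp (continuous_add_const h)
  have hint : ∀ x, IntervalIntegrable (fun r => (x - r) ^ (γ - 1) * F (u r)) volume 0 h :=
    fun x => intervalIntegrable_kernel_mul hγ x hFu.continuousOn
  have hwpos := pos_of_eq_sub_kernelConv (γ := γ) (c := c) (L := L)
    (w := fun t => u t - u (t + h)) (H := fun t => F (u t) - F (u (t + h)))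
    (G := fun t => c * ∫ r in (0:ℝ)..h, (t + h - r) ^ (γ - 1) * F (u r)) hγ hγ1 hc L.2
    (by fun_prop) (hFu.sub hFuh).continuousOn
    (fun t ht => by
      rw [hu t ht, hu (t + h) (by linarith), kernelConv_add_shift hγ hFu,
        ← kernelConv_sub hγ ht hFu.continuousOn hFuh.continuousOn]
      ring)
    (fun t _ hw => by
      have h1 := hmono (sub_nonneg.1 hw)
      refine ⟨sub_nonneg.2 h1, ?_⟩
      have h2 := hF.dist_le_mul (u t) (u (t + h))
      rw [Real.dist_eq, Real.dist_eq, abs_of_nonneg hw] at h2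
      exact (le_abs_self _).trans h2)
    (fun s t hs hst => by
      rw [mul_left_comm]
      refine mul_le_mul_of_nonneg_left ?_ hc.le
      rw [← intervalIntegral.integral_const_mul]
      refine intervalIntegral.integral_mono_on hh.le ((hint _).const_mul _) (hint _)
        fun r hr => ?_
      rw [← mul_assoc, add_sub_assoc, add_sub_assoc]
      exact mul_le_mul_of_nonneg_right
        (rpow_div_mul_rpow_le hγ1 hs (by linarith [hr.2]) hst) (hpos _).le)
    (by
      have h1 : 0 < kernelConv γ (fun s => F (u s)) h :=
        intervalIntegral.intervalIntegral_pos_of_pos_on (hint h)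
          (fun r hr => mul_pos (Real.rpow_pos_of_pos (by linarith [hr.2]) _) (hpos _)) hh
      have h2 := hu 0 le_rfl
      have h3 := hu h hh.le
      simp only [kernelConv, intervalIntegral.integral_same, mul_zero, sub_zero] at h2
      simp only [zero_add]
      rw [h2, h3]
      linarith [mul_pos hc h1]) ht
  exact (sub_pos.1 hwpos).le

lemma initial_le_add_mul {γ c u₀ s : ℝ} (hγ : 0 < γ) (hγ1 : γ < 1) (hc : 0 < c)
    {F : ℝ → ℝ} (hFc : Continuous F) (hmono : Monotone F) (hpos : ∀ x, 0 < F x)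
    {u : ℝ → ℝ} (huc : Continuous u) (hanti : AntitoneOn u (Ici 0))
    (hu : ∀ t, 0 ≤ t → u t = u₀ - c * kernelConv γ (fun s => F (u s)) t) (hs : 0 ≤ s) :
    u₀ ≤ u s + c / (γ * (1 - 2 ^ (γ - 1))) * s ^ γ * F (u s) := by
  rcases hs.eq_or_lt with rfl | hs
  · rw [Real.zero_rpow hγ.ne', hu 0 le_rfl]
    simp [kernelConv]
  have hκ : (2:ℝ) ^ (γ - 1) < 1 := Real.rpow_lt_one_of_one_lt_of_neg one_lt_two (by linarith)
  have hconv := kernelConv_le_of_le (t := 2 * s) hγ hγ1.le hs (by linarith)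
    (g := fun s => F (u s)) (M := F (u s)) (hFc.comp huc).continuousOn (fun r _ => (hpos _).le)
    (fun r hr => hmono (hanti hs.le (hs.le.trans hr.1) hr.1))
  have e1 := hu s hs.le
  have e2 := hu (2 * s) (by linarith)
  have hle : u (2 * s) ≤ u s := hanti hs.le (show (0:ℝ) ≤ 2 * s by linarith) (by linarith)
  rw [mul_div_assoc, div_self hs.ne', mul_one, show 2 * s - s = s by ring] at hconv
  set κ : ℝ := 2 ^ (γ - 1)
  have h1 : (1 - κ) * u₀ ≤ (1 - κ) * u s + c * (F (u s) * (s ^ γ / γ)) := by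
    have := mul_le_mul_of_nonneg_left hconv hc.le
    nlinarith
  have hκ' : 0 < 1 - κ := by linarith
  have h2 : (1 - κ) * (u s + c / (γ * (1 - κ)) * s ^ γ * F (u s)) =
      (1 - κ) * u s + c * (F (u s) * (s ^ γ / γ)) := by
    field_simp
  rw [← h2] at h1
  exact le_of_mul_le_mul_left h1 hκ'

lemma mul_rpow_le_initial_sub {γ c u₀ t : ℝ} (hγ : 0 < γ) (hc : 0 < c)
    {F : ℝ → ℝ} (hFc : Continuous F) (hmono : Monotone F)
    {u : ℝ → ℝ} (huc : Continuous u) (hanti : AntitoneOn u (Ici 0))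
    (hu : ∀ t, 0 ≤ t → u t = u₀ - c * kernelConv γ (fun s => F (u s)) t) (ht : 0 ≤ t) :
    c * (F (u t) * (t ^ γ / γ)) ≤ u₀ - u t := by
  rw [hu t ht, sub_sub_cancel]
  refine mul_le_mul_of_nonneg_left ?_ hc.le
  rw [← hu t ht]
  have hk := integral_kernel hγ 0 t
  rw [sub_zero] at hk
  rw [← hk, ← intervalIntegral.integral_const_mul]
  refine intervalIntegral.integral_mono_on ht ((intervalIntegrable_kernel hγ t 0 t).const_mul _)
    (intervalIntegrable_kernel_mul hγ t (hFc.comp huc).continuousOn) fun r hr => ?_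
  rw [mul_comm]
  exact mul_le_mul_of_nonneg_left (hmono (hanti hr.1 ht hr.2))
    (Real.rpow_nonneg (by linarith [hr.2]) _)

lemma exists_lipschitzOnWith_rpow {a : ℝ} (b p : ℝ) (ha : 0 < a) :
    ∃ L, LipschitzOnWith L (fun x : ℝ => x ^ p) (Icc a b) := by
  refine ContDiffOn.exists_lipschitzOnWith (n := 1) (fun x hx => ?_) one_ne_zero
    (convex_Icc a b) isCompact_Icc
  exact (Real.contDiffAt_rpow_const_of_ne (ha.trans_le hx.1).ne').contDiffWithinAt

/-- On every bounded time interval there is a positive solution of the power-law equation,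
with decay estimates uniform in the length of the interval. -/
lemma exists_solution_on_Icc {γ c p u₀ T : ℝ} (hγ : 0 < γ) (hγ1 : γ < 1) (hc : 0 < c)
    (hp : 0 < p) (hu₀ : 0 < u₀) (hT : 0 ≤ T) :
    ∃ u : ℝ → ℝ, Continuous u ∧ ∀ t ∈ Icc 0 T, 0 < u t ∧
      u t = u₀ - c * kernelConv γ (fun s => u s ^ p) t ∧
      u₀ ≤ u t + c / (γ * (1 - 2 ^ (γ - 1))) * t ^ γ * u t ^ p ∧
      c * (u t ^ p * (t ^ γ / γ)) ≤ u₀ - u t := by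
  set C : ℝ := c / (γ * (1 - 2 ^ (γ - 1))) with hC
  have hκ : (2:ℝ) ^ (γ - 1) < 1 := Real.rpow_lt_one_of_one_lt_of_neg one_lt_two (by linarith)
  have hCp : 0 < C := div_pos hc (mul_pos hγ (by linarith))
  obtain ⟨ε, hεT, hεp⟩ : ∃ ε : ℝ, ε + C * T ^ γ * ε ^ p < u₀ ∧ 0 < ε := by
    have hcont : Continuous fun ε : ℝ => ε + C * T ^ γ * ε ^ p := by
      have := Real.continuous_rpow_const hp.le
      fun_prop
    have hlim := hcont.tendsto 0
    simp only [Real.zero_rpow hp.ne', mul_zero, add_zero] at hlim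
    have h1 := (hlim.eventually_lt_const hu₀).filter_mono
      (nhdsWithin_le_nhds (s := Ioi 0))
    exact (h1.and self_mem_nhdsWithin).exists
  have hεu : ε ≤ u₀ := by
    have : 0 ≤ C * T ^ γ * ε ^ p := by positivity
    linarith
  obtain ⟨L, hL⟩ := exists_lipschitzOnWith_rpow u₀ p hεp
  let F : ℝ → ℝ := fun x => (projIcc ε u₀ hεu x : ℝ) ^ p
  have hproj : ∀ x, 0 < (projIcc ε u₀ hεu x : ℝ) := fun x =>
    hεp.trans_le (projIcc ε u₀ hεu x).2.1
  have hF : LipschitzWith L F := LipschitzWith.of_dist_le_mul fun x y => by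
    refine (hL.dist_le_mul _ (projIcc ε u₀ hεu x).2 _ (projIcc ε u₀ hεu y).2).trans ?_
    gcongr
    have := (LipschitzWith.projIcc hεu).dist_le_mul x y
    rwa [NNReal.coe_one, one_mul] at this
  have hpos : ∀ x, 0 < F x := fun x => Real.rpow_pos_of_pos (hproj x) p
  have hmono : Monotone F := fun x y hxy =>
    Real.rpow_le_rpow (hproj x).le (monotone_projIcc hεu hxy) hp.le
  have hB : ∀ x, |F x| ≤ u₀ ^ p := fun x => by
    rw [abs_of_pos (hpos x)]
    exact Real.rpow_le_rpow (hproj x).le (projIcc ε u₀ hεu x).2.2 hp.le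
  obtain ⟨u, huc, hu⟩ := exists_continuous_solution u₀ hγ hc hF hB
  have hanti := solution_antitoneOn hγ hγ1.le hc hF hmono hpos huc hu
  have hlow : ∀ t : ℝ, 0 ≤ t → _ := fun t ht =>
    initial_le_add_mul (s := t) hγ hγ1 hc hF.continuous hmono hpos huc hanti hu ht
  have hupp : ∀ t : ℝ, 0 ≤ t → _ := fun t ht =>
    mul_rpow_le_initial_sub hγ hc hF.continuous hmono huc hanti hu ht
  have hu0 : u 0 = u₀ := by simp [hu 0 le_rfl, kernelConv]
  have hmem : ∀ t ∈ Icc 0 T, u t ∈ Icc ε u₀ := fun t ht => by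
    refine ⟨?_, hu0 ▸ hanti self_mem_Ici ht.1 ht.1⟩
    by_contra! hlt
    have h1 := hlow t ht.1
    have h2 : F (u t) = ε ^ p := by simp only [F, projIcc_of_le_left hεu hlt.le]
    rw [h2, ← hC] at h1
    have h3 : C * t ^ γ * ε ^ p ≤ C * T ^ γ * ε ^ p := by
      have := Real.rpow_le_rpow ht.1 ht.2 hγ.le
      gcongr
    linarith
  have hFu : ∀ t ∈ Icc 0 T, F (u t) = u t ^ p := fun t ht => by
    simp only [F, projIcc_of_mem hεu (hmem t ht)]
  refine ⟨u, huc, fun t ht => ⟨hεp.trans_le (hmem t ht).1, ?_, ?_, ?_⟩⟩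
  · rw [hu t ht.1, kernelConv_congr ht.1 fun s hs => hFu s ⟨hs.1, hs.2.trans ht.2⟩]
  · rw [← hFu t ht]; exact hlow t ht.1
  · rw [← hFu t ht]; exact hupp t ht.1

lemma solution_eqOn_Icc {γ c p u₀ T : ℝ} (hγ : 0 < γ) (hc : 0 < c) (hT : 0 ≤ T)
    {u v : ℝ → ℝ} (hu : Continuous u) (hv : Continuous v)
    (hub : ∀ t ∈ Icc 0 T, 0 < u t ∧ u t ≤ u₀) (hvb : ∀ t ∈ Icc 0 T, 0 < v t ∧ v t ≤ u₀)
    (hu_eq : ∀ t ∈ Icc 0 T, u t = u₀ - c * kernelConv γ (fun s => u s ^ p) t)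
    (hv_eq : ∀ t ∈ Icc 0 T, v t = u₀ - c * kernelConv γ (fun s => v s ^ p) t) :
    EqOn u v (Icc 0 T) := by
  obtain ⟨x, hx, hxmin⟩ := isCompact_Icc.exists_isMinOn (nonempty_Icc.2 hT) hu.continuousOn
  obtain ⟨y, hy, hymin⟩ := isCompact_Icc.exists_isMinOn (nonempty_Icc.2 hT) hv.continuousOn
  obtain ⟨L, hL⟩ := exists_lipschitzOnWith_rpow u₀ p (lt_min (hub x hx).1 (hvb y hy).1)
  exact solution_unique hγ hc hL hu.continuousOn hv.continuousOn
    (fun t ht => ⟨(min_le_left _ _).trans (hxmin ht), (hub t ht).2⟩)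
    (fun t ht => ⟨(min_le_right _ _).trans (hymin ht), (hvb t ht).2⟩) hu_eq hv_eq

lemma mul_rpow_neg_rpow_inv {γ p D t : ℝ} (hD : 0 ≤ D) (ht : 0 ≤ t) :
    (D * t ^ (-γ)) ^ p⁻¹ = D ^ p⁻¹ * t ^ (-(γ / p)) := by
  rw [Real.mul_rpow hD (Real.rpow_nonneg ht _), ← Real.rpow_mul ht, div_eq_mul_inv, neg_mul]

/-- For `A < 0`, `p > 0`, the solution of `D_c^γ u = A u^p`, `u(0)=u₀>0`,
exists globally, stays strictly positive, and decays like `t^(−γ/p)`: there are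
`c₁, c₂ > 0` with `c₁ t^(−γ/p) ≤ u(t) ≤ c₂ t^(−γ/p)` for all `t ≥ 1`. -/
theorem fractional_ode_algebraic_decay
    (γ A p u₀ : ℝ) (hγ : γ ∈ Set.Ioo (0:ℝ) 1) (hA : A < 0) (hp : 0 < p) (hu₀ : 0 < u₀) :
    ∃ u : ℝ → ℝ, ContinuousOn u (Set.Ici 0) ∧ u 0 = u₀ ∧
      (∀ t : ℝ, 0 ≤ t → 0 < u t) ∧
      (∀ t : ℝ, 0 ≤ t →
        u t = u₀ + (A / Real.Gamma γ) * ∫ s in (0:ℝ)..t, (t - s) ^ (γ - 1) * u s ^ p) ∧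
      ∃ c₁ > (0:ℝ), ∃ c₂ > (0:ℝ), ∀ t : ℝ, 1 ≤ t →
        c₁ * t ^ (-(γ / p)) ≤ u t ∧ u t ≤ c₂ * t ^ (-(γ / p)) := by
  obtain ⟨hγ0, hγ1⟩ := hγ
  obtain ⟨c, hc_eq⟩ : ∃ c, c = -(A / Real.Gamma γ) := ⟨_, rfl⟩
  have hc : 0 < c := by
    rw [hc_eq, neg_pos]; exact div_neg_of_neg_of_pos hA (Real.Gamma_pos_of_pos hγ0)
  have hA_eq : A / Real.Gamma γ = -c := by rw [hc_eq, neg_neg]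
  have hκ : (2:ℝ) ^ (γ - 1) < 1 := Real.rpow_lt_one_of_one_lt_of_neg one_lt_two (by linarith)
  obtain ⟨C, hC⟩ : ∃ C, C = c / (γ * (1 - 2 ^ (γ - 1))) := ⟨_, rfl⟩
  have hCp : 0 < C := hC ▸ div_pos hc (mul_pos hγ0 (by linarith))
  choose U hUc hU using fun n : ℕ =>
    exists_solution_on_Icc hγ0 hγ1 hc hp hu₀ (Nat.cast_nonneg (α := ℝ) n)
  have hUle : ∀ n : ℕ, ∀ t ∈ Icc (0:ℝ) n, U n t ≤ u₀ := fun n t ht => by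
    have h1 := (hU n t ht).2.2.2
    have h2 := Real.rpow_nonneg (hU n t ht).1.le p
    have h3 := Real.rpow_nonneg ht.1 γ
    have h4 : 0 ≤ c * (U n t ^ p * (t ^ γ / γ)) := by positivity
    linarith
  have hmono : ∀ n m : ℕ, n ≤ m → EqOn (U n) (U m) (Icc 0 n) := fun n m hnm => by
    have hsub : Icc (0:ℝ) n ⊆ Icc 0 m := Icc_subset_Icc_right (by exact_mod_cast hnm)
    exact solution_eqOn_Icc hγ0 hc n.cast_nonneg (hUc n) (hUc m)
      (fun t ht => ⟨(hU n t ht).1, hUle n t ht⟩)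
      (fun t ht => ⟨(hU m t (hsub ht)).1, hUle m t (hsub ht)⟩)
      (fun t ht => (hU n t ht).2.1) (fun t ht => (hU m t (hsub ht)).2.1)
  let u : ℝ → ℝ := fun t => U ⌈t⌉₊ t
  have huU : ∀ n : ℕ, ∀ t ∈ Icc (0:ℝ) n, u t = U n t := fun n t ht =>
    hmono ⌈t⌉₊ n (Nat.ceil_le.2 ht.2) ⟨ht.1, Nat.le_ceil t⟩
  have hu : ∀ t, 0 ≤ t → 0 < u t ∧ u t = u₀ - c * kernelConv γ (fun s => u s ^ p) t ∧
      u₀ ≤ u t + C * t ^ γ * u t ^ p ∧ c * (u t ^ p * (t ^ γ / γ)) ≤ u₀ - u t := fun t ht => by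
    have htmem : t ∈ Icc (0:ℝ) ⌈t⌉₊ := ⟨ht, Nat.le_ceil t⟩
    obtain ⟨h1, h2, h3, h4⟩ := hU ⌈t⌉₊ t htmem
    rw [← hC] at h3
    refine ⟨h1, ?_, h3, h4⟩
    rw [kernelConv_congr ht (g := fun s => U ⌈t⌉₊ s ^ p) fun s hs => by
      rw [huU ⌈t⌉₊ s ⟨hs.1, hs.2.trans htmem.2⟩]]
    exact h2
  refine ⟨u, fun t ht => ?_, ?_, fun t ht => (hu t ht).1, fun t ht => ?_, ?_⟩
  · have hlt : t < (⌈t⌉₊ + 1 : ℕ) := by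
      push_cast; linarith [Nat.le_ceil t]
    refine (hUc (⌈t⌉₊ + 1)).continuousWithinAt.congr_of_eventuallyEq ?_ (huU _ t ⟨ht, hlt.le⟩)
    filter_upwards [self_mem_nhdsWithin, mem_nhdsWithin_of_mem_nhds (Iio_mem_nhds hlt)]
      with s hs hs'
    exact huU _ s ⟨hs, le_of_lt hs'⟩
  · rw [(hu 0 le_rfl).2.1]; simp [kernelConv]
  · rw [hA_eq, neg_mul, ← sub_eq_add_neg]
    exact (hu t ht).2.1
  · refine ⟨min (u₀ / 2) ((u₀ / (2 * C)) ^ p⁻¹), lt_min (by positivity) (by positivity),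
      (u₀ * γ / c) ^ p⁻¹, by positivity, fun t ht => ?_⟩
    have ht0 : 0 < t := by linarith
    obtain ⟨h1, -, h3, h4⟩ := hu t ht0.le
    have htγ : 0 < t ^ γ := Real.rpow_pos_of_pos ht0 γ
    have hinv : (u t ^ p) ^ p⁻¹ = u t := Real.rpow_rpow_inv h1.le hp.ne'
    have hup : 0 < u t ^ p := Real.rpow_pos_of_pos h1 p
    have hdec : 0 < t ^ (-(γ / p)) := Real.rpow_pos_of_pos ht0 _
    constructor
    · rcases le_total (u₀ / 2) (u t) with h | h
      · have h5 : t ^ (-(γ / p)) ≤ 1 :=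
          Real.rpow_le_one_of_one_le_of_nonpos ht (neg_nonpos.2 (by positivity))
        calc _ ≤ u₀ / 2 * 1 := by
              gcongr
              exact min_le_left _ _
          _ ≤ u t := by rwa [mul_one]
      · have h5 : u₀ / (2 * C) * t ^ (-γ) ≤ u t ^ p := by
          rw [Real.rpow_neg ht0.le, ← div_eq_mul_inv, div_div, div_le_iff₀ (by positivity)]
          nlinarith
        calc _ ≤ (u₀ / (2 * C)) ^ p⁻¹ * t ^ (-(γ / p)) := by
              gcongr
              exact min_le_right _ _
          _ = (u₀ / (2 * C) * t ^ (-γ)) ^ p⁻¹ :=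
              (mul_rpow_neg_rpow_inv (by positivity) ht0.le).symm
          _ ≤ (u t ^ p) ^ p⁻¹ := by gcongr
          _ = u t := hinv
    · have h5 : u t ^ p ≤ u₀ * γ / c * t ^ (-γ) := by
        rw [Real.rpow_neg ht0.le, ← div_eq_mul_inv, div_div, le_div_iff₀ (by positivity)]
        have h6 : c * (u t ^ p * (t ^ γ / γ)) * γ = u t ^ p * (c * t ^ γ) := by field_simp
        rw [← h6]
        exact mul_le_mul_of_nonneg_right (by linarith) hγ0.le
      calc u t = (u t ^ p) ^ p⁻¹ := hinv.symm
        _ ≤ (u₀ * γ / c * t ^ (-γ)) ^ p⁻¹ := by gcongr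
        _ = _ := mul_rpow_neg_rpow_inv (by positivity) ht0.le
end

section
/- Let γ ∈ (0,1), p ∈ ℝ, u₀ > 0, and let u : [0,T_b) → (0,∞) be a continuous positive solution of u(t) = u₀ + (A/Γ(γ)) ∫₀ᵗ (t−s)^(γ−1) u(s)^p ds. If A = 0 then u(t) = u₀ for all t. If A > 0 then u is strictly increasing on [0,T_b). If A < 0 then u is strictly decreasing on [0,T_b). -/
open MeasureTheory Set Filter

/-- The singular kernel times a continuous function is integrable. -/
lemma intervalIntegrable_rpow_sub_mul {γ a b t : ℝ} (hγ : 0 < γ) {z : ℝ → ℝ}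
    (hz : ContinuousOn z (uIcc a b)) :
    IntervalIntegrable (fun s => (t - s) ^ (γ - 1) * z s) volume a b := by
  have h : IntervalIntegrable (fun s : ℝ => s ^ (γ - 1)) volume (t - a) (t - b) :=
    intervalIntegral.intervalIntegrable_rpow' (by linarith)
  have h' := h.comp_sub_left t
  simp only [sub_sub_cancel] at h'
  exact h'.mul_continuousOn hz

/-- If a continuous function is positive at `0` and cannot be the first to vanish, it stays
positive. -/
lemma pos_of_no_first_zero {y : ℝ → ℝ} {T : ℝ} (hT : 0 ≤ T) (hy : ContinuousOn y (Icc 0 T))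
    (hstep : ∀ t ∈ Icc 0 T, (∀ s ∈ Ico 0 t, 0 < y s) → 0 < y t) : 0 < y T := by
  by_contra! hneg
  have hcl : IsClosed (Icc 0 T ∩ y ⁻¹' Iic 0) :=
    hy.preimage_isClosed_of_isClosed isClosed_Icc isClosed_Iic
  obtain ⟨t, ⟨htI, hty⟩, hmin⟩ :=
    (isCompact_Icc.of_isClosed_subset hcl inter_subset_left).exists_isLeast
      ⟨T, right_mem_Icc.2 hT, hneg⟩
  refine absurd (hstep t htI fun s hs => ?_) (not_lt.2 hty)
  by_contra! hs0
  exact absurd (hmin ⟨⟨hs.1, hs.2.le.trans htI.2⟩, hs0⟩) (not_le.2 hs.2)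

/-- Integrated kernel over a terminal interval. -/
lemma integral_rpow_sub {γ t T : ℝ} (hγ : 0 < γ) :
    ∫ s in t..T, (T - s) ^ (γ - 1) = (T - t) ^ γ / γ := by
  rw [intervalIntegral.integral_comp_sub_left (fun s : ℝ => s ^ (γ - 1)) T,
    integral_rpow (Or.inl (by linarith))]
  simp [Real.zero_rpow hγ.ne']

/-- Miller's positivity argument: the solution of a linear-type Volterra equation with kernel
`s ^ (γ - 1)` and forcing `G`, where `G` decays no faster than the kernel, cannot reach zero. -/
lemma volterra_pos_endpoint {γ T L : ℝ} (hγ : γ ∈ Ioo (0 : ℝ) 1) (hT : 0 < T)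
    {y z G : ℝ → ℝ} (hy : ContinuousOn y (Icc 0 T)) (hz : ContinuousOn z (Icc 0 T))
    (heq : ∀ t ∈ Icc 0 T, y t = G t - ∫ s in (0 : ℝ)..t, (t - s) ^ (γ - 1) * z s)
    (hG : ∀ t ∈ Ioo 0 T, T ^ (γ - 1) * G t ≤ t ^ (γ - 1) * G T)
    (hypos : ∀ t ∈ Ico 0 T, 0 < y t)
    (hz0 : ∀ t ∈ Ico 0 T, 0 ≤ z t) (hzL : ∀ t ∈ Ico 0 T, z t ≤ L * y t) (hL : 0 ≤ L) :
    0 < y T := by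
  obtain ⟨hγ0, hγ1⟩ := hγ
  by_contra! hneg
  have hlim : ContinuousAt
      (fun t : ℝ => T ^ (γ - 1) - t ^ (γ - 1) * (L * ((T - t) ^ γ / γ))) T := by
    have h1 : ContinuousAt (fun t : ℝ => t ^ (γ - 1)) T :=
      Real.continuousAt_rpow_const _ _ (Or.inl hT.ne')
    have h2 : ContinuousAt (fun t : ℝ => (T - t) ^ γ) T :=
      (continuousAt_const.sub continuousAt_id).rpow_const (Or.inr hγ0.le)
    exact continuousAt_const.sub (h1.mul (continuousAt_const.mul (h2.div_const γ)))
  have hev : ∀ᶠ t in nhds T, 0 < T ^ (γ - 1) - t ^ (γ - 1) * (L * ((T - t) ^ γ / γ)) := by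
    refine hlim.eventually (lt_mem_nhds ?_)
    simpa [Real.zero_rpow hγ0.ne'] using Real.rpow_pos_of_pos hT _
  obtain ⟨δ, hδ, hball⟩ := Metric.eventually_nhds_iff.1 hev
  obtain ⟨t₀, ht₀, ht₀T⟩ := exists_between (max_lt hT (sub_lt_self T hδ))
  obtain ⟨ht₀0, ht₀δ⟩ := max_lt_iff.1 ht₀
  obtain ⟨t, ht, hmax⟩ := isCompact_Icc.exists_isMaxOn (nonempty_Icc.2 ht₀T.le)
    (hy.mono (Icc_subset_Icc_left ht₀0.le))
  have hyt : 0 < y t :=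
    (hypos t₀ ⟨ht₀0.le, ht₀T⟩).trans_le (hmax (left_mem_Icc.2 ht₀T.le))
  have htT : t < T := lt_of_le_of_ne ht.2 (by rintro rfl; linarith)
  have ht0 : 0 < t := ht₀0.trans_le ht.1
  have hkt : 0 < t ^ (γ - 1) := Real.rpow_pos_of_pos ht0 _
  have hgap := hball (y := t) (by rw [Real.dist_eq, abs_lt]; constructor <;> linarith [ht.1])
  have hint : ∀ r a b, a ∈ Icc 0 T → b ∈ Icc 0 T →
      IntervalIntegrable (fun s => (r - s) ^ (γ - 1) * z s) volume a b := fun r a b ha hb =>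
    intervalIntegrable_rpow_sub_mul hγ0 (hz.mono (uIcc_subset_Icc ha hb))
  have m0 : (0 : ℝ) ∈ Icc 0 T := left_mem_Icc.2 hT.le
  have mT : T ∈ Icc 0 T := right_mem_Icc.2 hT.le
  have mt : t ∈ Icc 0 T := ⟨ht0.le, htT.le⟩
  have hpast : t ^ (γ - 1) * (∫ s in (0 : ℝ)..t, (T - s) ^ (γ - 1) * z s) ≤
      T ^ (γ - 1) * ∫ s in (0 : ℝ)..t, (t - s) ^ (γ - 1) * z s := by
    rw [← intervalIntegral.integral_const_mul, ← intervalIntegral.integral_const_mul]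
    refine intervalIntegral.integral_mono_on_of_le_Ioo ht0.le ((hint _ _ _ m0 mt).const_mul _)
      ((hint _ _ _ m0 mt).const_mul _) fun s hs => ?_
    rw [← mul_assoc, ← mul_assoc]
    refine mul_le_mul_of_nonneg_right ?_ (hz0 s ⟨hs.1.le, hs.2.trans htT⟩)
    rw [← Real.mul_rpow ht0.le (by linarith [hs.2]), ← Real.mul_rpow hT.le (by linarith [hs.2])]
    exact Real.rpow_le_rpow_of_nonpos (mul_pos hT (by linarith [hs.2]))
      (by nlinarith [hs.1]) (by linarith)
  have hrecent : (∫ s in t..T, (T - s) ^ (γ - 1) * z s) ≤ L * y t * ((T - t) ^ γ / γ) := by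
    rw [← integral_rpow_sub hγ0, mul_comm, ← intervalIntegral.integral_mul_const]
    refine intervalIntegral.integral_mono_on_of_le_Ioo htT.le (hint _ _ _ mt mT)
      (intervalIntegrable_rpow_sub_mul hγ0 continuousOn_const) fun s hs => ?_
    refine mul_le_mul_of_nonneg_left ?_ (Real.rpow_nonneg (by linarith [hs.2]) _)
    exact (hzL s ⟨(ht0.trans hs.1).le, hs.2⟩).trans
      (mul_le_mul_of_nonneg_left (hmax ⟨ht.1.trans hs.1.le, hs.2.le⟩) hL)
  have hsplit := intervalIntegral.integral_add_adjacent_intervals (hint T 0 t m0 mt)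
    (hint T t T mt mT)
  have eT := heq T mT
  rw [← hsplit] at eT
  have et := heq t mt
  have h1 : 0 < t ^ (γ - 1) * y T := by
    have h2 := mul_le_mul_of_nonneg_left hrecent hkt.le
    have h3 := mul_pos hyt hgap
    have h4 := hG t ⟨ht0, htT⟩
    have h5 : T ^ (γ - 1) * y t = T ^ (γ - 1) * G t -
      T ^ (γ - 1) * ∫ s in (0 : ℝ)..t, (t - s) ^ (γ - 1) * z s := by rw [et]; ring
    rw [eT]
    linarith
  exact absurd (pos_of_mul_pos_right h1 hkt.le) (not_lt.2 hneg)

/-- Increments of a solution of the Volterra equation have the sign of the coefficient. -/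
lemma volterra_power_increment_pos {γ p u₀ c σ a b : ℝ} (hγ : γ ∈ Ioo (0 : ℝ) 1) (hc : 0 < c)
    (hσ : σ = 1 ∨ σ = -1) (ha : 0 ≤ a) (hab : a < b) {u : ℝ → ℝ}
    (hpos : ∀ t ∈ Icc 0 b, 0 < u t) (hcont : ContinuousOn u (Icc 0 b))
    (heq : ∀ t ∈ Icc 0 b,
      u t = u₀ + σ * c * ∫ s in (0 : ℝ)..t, (t - s) ^ (γ - 1) * u s ^ p) :
    0 < σ * (u b - u a) := by
  have hγ0 := hγ.1
  have hγ1 := hγ.2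
  obtain ⟨h, hh, rfl⟩ : ∃ h, 0 < h ∧ b = a + h := ⟨b - a, by linarith, by ring⟩
  have hσσ : σ * σ = 1 := by rcases hσ with rfl | rfl <;> norm_num
  have hshift : MapsTo (· + h) (Icc 0 a) (Icc 0 (a + h)) := fun t ht =>
    ⟨by linarith [ht.1], by linarith [ht.2]⟩
  have hsub : Icc 0 a ⊆ Icc 0 (a + h) := Icc_subset_Icc_right (by linarith)
  have hucont := hcont.mono hsub
  have hwcont : ContinuousOn (fun t => u (t + h)) (Icc 0 a) :=
    hcont.comp (continuous_add_const h).continuousOn hshift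
  have hfu : ContinuousOn (fun t => u t ^ p) (Icc 0 (a + h)) :=
    hcont.rpow_const fun t ht => Or.inl (hpos t ht).ne'
  have hfw : ContinuousOn (fun t => u (t + h) ^ p) (Icc 0 a) :=
    hwcont.rpow_const fun t ht => Or.inl (hpos _ (hshift ht)).ne'
  set y : ℝ → ℝ := fun t => σ * (u (t + h) - u t) with hy_def
  set z : ℝ → ℝ := fun t => c * (u t ^ p - u (t + h) ^ p) with hz_def
  set G : ℝ → ℝ := fun t => c * ∫ s in (0 : ℝ)..h, (t + h - s) ^ (γ - 1) * u s ^ p with hG_def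
  have hycont : ContinuousOn y (Icc 0 a) := continuousOn_const.mul (hwcont.sub hucont)
  have hzcont : ContinuousOn z (Icc 0 a) := continuousOn_const.mul ((hfu.mono hsub).sub hfw)
  have hhI : h ∈ Icc 0 (a + h) := ⟨hh.le, by linarith⟩
  have h0I : (0 : ℝ) ∈ Icc 0 (a + h) := ⟨le_rfl, by linarith⟩
  have hint : ∀ r s t, s ∈ Icc 0 (a + h) → t ∈ Icc 0 (a + h) →
      IntervalIntegrable (fun x => (r - x) ^ (γ - 1) * u x ^ p) volume s t :=
    fun r s t hs ht => intervalIntegrable_rpow_sub_mul hγ0 (hfu.mono (uIcc_subset_Icc hs ht))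
  have hyeq : ∀ t ∈ Icc 0 a, y t = G t - ∫ s in (0 : ℝ)..t, (t - s) ^ (γ - 1) * z s := by
    intro t ht
    have hsplit := intervalIntegral.integral_add_adjacent_intervals
      (hint (t + h) 0 h h0I hhI) (hint (t + h) h (t + h) hhI (hshift ht))
    have htrans : (∫ s in h..(t + h), (t + h - s) ^ (γ - 1) * u s ^ p) =
        ∫ s in (0 : ℝ)..t, (t - s) ^ (γ - 1) * u (s + h) ^ p := by
      have := intervalIntegral.integral_comp_add_right (a := 0) (b := t)
        (fun s => (t + h - s) ^ (γ - 1) * u s ^ p) h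
      simpa only [add_sub_add_right_eq_sub, zero_add] using this.symm
    have hzint : (∫ s in (0 : ℝ)..t, (t - s) ^ (γ - 1) * z s) =
        c * ((∫ s in (0 : ℝ)..t, (t - s) ^ (γ - 1) * u s ^ p) -
          ∫ s in (0 : ℝ)..t, (t - s) ^ (γ - 1) * u (s + h) ^ p) := by
      rw [← intervalIntegral.integral_sub (hint t 0 t h0I (hsub ht))
        (intervalIntegrable_rpow_sub_mul hγ0
          (hfw.mono (uIcc_subset_Icc ⟨le_rfl, ha⟩ ht))),
        ← intervalIntegral.integral_const_mul]
      exact intervalIntegral.integral_congr fun s _ => by simp only [hz_def]; ring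
    have e1 := heq _ (hshift ht)
    have e2 := heq t (hsub ht)
    simp only [← hsplit, htrans] at e1
    simp only [hy_def, hG_def, hzint, e1, e2]
    linear_combination (c * (∫ s in (0 : ℝ)..h, (t + h - s) ^ (γ - 1) * u s ^ p) +
      c * (∫ s in (0 : ℝ)..t, (t - s) ^ (γ - 1) * u (s + h) ^ p) -
      c * (∫ s in (0 : ℝ)..t, (t - s) ^ (γ - 1) * u s ^ p)) * hσσ
  have hGpos : ∀ t ∈ Icc 0 a, 0 < G t := fun t ht => by
    refine mul_pos hc (intervalIntegral.intervalIntegral_pos_of_pos_on (hint _ _ _ h0I hhI)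
      (fun s hs => ?_) hh)
    exact mul_pos (Real.rpow_pos_of_pos (by linarith [ht.1, hs.2]) _)
      (Real.rpow_pos_of_pos (hpos s ⟨hs.1.le, by linarith [hs.2]⟩) _)
  have hGratio : ∀ T ∈ Icc 0 a, ∀ t ∈ Ioo 0 T, T ^ (γ - 1) * G t ≤ t ^ (γ - 1) * G T := by
    intro T hT t ht
    have hT0 : 0 < T := ht.1.trans ht.2
    simp only [hG_def, mul_left_comm _ c]
    refine mul_le_mul_of_nonneg_left ?_ hc.le
    rw [← intervalIntegral.integral_const_mul, ← intervalIntegral.integral_const_mul]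
    refine intervalIntegral.integral_mono_on_of_le_Ioo hh.le ((hint _ _ _ h0I hhI).const_mul _)
      ((hint _ _ _ h0I hhI).const_mul _) fun s hs => ?_
    have hth : 0 < t + h - s := by linarith [hs.2, ht.1]
    have hTh : 0 < T + h - s := by linarith [hs.2]
    rw [← mul_assoc, ← mul_assoc, ← Real.mul_rpow hT0.le hth.le, ← Real.mul_rpow ht.1.le hTh.le]
    refine mul_le_mul_of_nonneg_right ?_
      (Real.rpow_nonneg (hpos s ⟨hs.1.le, by linarith [hs.2]⟩).le _)
    exact Real.rpow_le_rpow_of_nonpos (mul_pos ht.1 hTh)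
      (by nlinarith [hs.2, ht.2]) (by linarith)
  have hposw : ∀ t ∈ Icc 0 a, 0 < u (t + h) := fun t ht => hpos _ (hshift ht)
  have hposu : ∀ t ∈ Icc 0 a, 0 < u t := fun t ht => hpos _ (hsub ht)
  have hcases : (∀ t ∈ Icc 0 a, 0 < y t → z t ≤ 0) ∨ (∀ t ∈ Icc 0 a, 0 < y t → 0 ≤ z t) := by
    simp only [hy_def, hz_def]
    rcases hσ with rfl | rfl <;> rcases le_total 0 p with hp | hp
    · exact Or.inl fun t ht hyt => mul_nonpos_of_nonneg_of_nonpos hc.le <| sub_nonpos.2 <|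
        Real.rpow_le_rpow (hposu t ht).le (by linarith) hp
    · exact Or.inr fun t ht hyt => mul_nonneg hc.le <| sub_nonneg.2 <|
        Real.rpow_le_rpow_of_nonpos (hposu t ht) (by linarith) hp
    · exact Or.inr fun t ht hyt => mul_nonneg hc.le <| sub_nonneg.2 <|
        Real.rpow_le_rpow (hposw t ht).le (by linarith) hp
    · exact Or.inl fun t ht hyt => mul_nonpos_of_nonneg_of_nonpos hc.le <| sub_nonpos.2 <|
        Real.rpow_le_rpow_of_nonpos (hposw t ht) (by linarith) hp
  obtain ⟨L, hL, hzL⟩ : ∃ L, 0 ≤ L ∧ ∀ t ∈ Icc 0 a, 0 < y t → z t ≤ L * y t := by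
    obtain ⟨t₁, ht₁, hmin⟩ := isCompact_Icc.exists_isMinOn ⟨0, h0I⟩ hcont
    obtain ⟨t₂, ht₂, hmax⟩ := isCompact_Icc.exists_isMaxOn ⟨0, h0I⟩ hcont
    have hC1 : ContDiffOn ℝ 1 (fun x : ℝ => x ^ p) (Icc (u t₁) (u t₂)) := fun x hx =>
      (Real.contDiffAt_rpow_const_of_ne ((hpos t₁ ht₁).trans_le hx.1).ne').contDiffWithinAt
    obtain ⟨K, hK⟩ := hC1.exists_lipschitzOnWith one_ne_zero (convex_Icc _ _) isCompact_Icc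
    refine ⟨c * K, by positivity, fun t ht hyt => ?_⟩
    have hlip := hK.dist_le_mul (u t) ⟨hmin (hsub ht), hmax (hsub ht)⟩ (u (t + h))
      ⟨hmin (hshift ht), hmax (hshift ht)⟩
    rw [Real.dist_eq, Real.dist_eq] at hlip
    have hyabs : |u t - u (t + h)| = y t := by
      rw [← abs_of_pos hyt, hy_def, abs_sub_comm, abs_mul]
      rcases hσ with rfl | rfl <;> simp
    rw [hyabs] at hlip
    rw [mul_assoc]
    exact mul_le_mul_of_nonneg_left ((le_abs_self _).trans hlip) hc.le
  refine pos_of_no_first_zero (y := y) ha hycont fun T hT hprev => ?_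
  have hsubT : Icc 0 T ⊆ Icc 0 a := Icc_subset_Icc_right hT.2
  have hIco : ∀ {t}, t ∈ Ico 0 T → t ∈ Icc 0 a := fun ht => hsubT (Ico_subset_Icc_self ht)
  rcases hT.1.eq_or_lt with rfl | hT0
  · rw [hyeq 0 hT]
    simpa using hGpos 0 hT
  rcases hcases with hz | hz
  · rw [hyeq T hT]
    have hnonneg : 0 ≤ ∫ s in (0 : ℝ)..T, -((T - s) ^ (γ - 1) * z s) := by
      have hi : IntervalIntegrable (fun s => -((T - s) ^ (γ - 1) * z s)) volume 0 T :=
        (intervalIntegrable_rpow_sub_mul hγ0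
          (hzcont.mono (uIcc_subset_Icc ⟨le_rfl, ha⟩ hT))).neg
      have := intervalIntegral.integral_mono_on_of_le_Ioo hT0.le
        (intervalIntegrable_const (c := (0 : ℝ))) hi fun s hs => by
          have hs' : s ∈ Ico 0 T := ⟨hs.1.le, hs.2⟩
          exact neg_nonneg.2 (mul_nonpos_of_nonneg_of_nonpos
            (Real.rpow_nonneg (by linarith [hs.2]) _) (hz s (hIco hs') (hprev s hs')))
      simpa using this
    rw [intervalIntegral.integral_neg] at hnonneg
    linarith [hGpos T hT]
  · exact volterra_pos_endpoint hγ hT0 (hycont.mono hsubT) (hzcont.mono hsubT)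
      (fun t ht => hyeq t (hsubT ht)) (hGratio T hT) hprev
      (fun t ht => hz t (hIco ht) (hprev t ht)) (fun t ht => hzL t (hIco ht) (hprev t ht)) hL

/-- For a continuous positive solution of `D_c^γ u = A u^p`:
if `A = 0` the solution is constant, if `A > 0` it is strictly increasing, and
if `A < 0` it is strictly decreasing on `[0,T_b)`. -/
theorem fractional_ode_monotonicity
    (γ A p u₀ Tb : ℝ) (hγ : γ ∈ Set.Ioo (0:ℝ) 1) (hu₀ : 0 < u₀) (hTb : 0 < Tb)
    (u : ℝ → ℝ)
    (hu0 : u 0 = u₀)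
    (hpos : ∀ t ∈ Set.Ico 0 Tb, 0 < u t)
    (hcont : ContinuousOn u (Set.Ico 0 Tb))
    (heq : ∀ t ∈ Set.Ico 0 Tb,
      u t = u₀ + (A / Real.Gamma γ) * ∫ s in (0:ℝ)..t, (t - s) ^ (γ - 1) * u s ^ p) :
    (A = 0 → ∀ t ∈ Set.Ico 0 Tb, u t = u₀) ∧
    (0 < A → StrictMonoOn u (Set.Ico 0 Tb)) ∧
    (A < 0 → StrictAntiOn u (Set.Ico 0 Tb)) := by
  have hΓ : 0 < Real.Gamma γ := Real.Gamma_pos_of_pos hγ.1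
  have hsub : ∀ b < Tb, Icc 0 b ⊆ Ico 0 Tb := fun b hb => Icc_subset_Ico_right hb
  refine ⟨fun hA t ht => ?_, fun hA a ha b hb hab => ?_, fun hA a ha b hb hab => ?_⟩
  · rw [heq t ht, hA]
    simp
  · have := volterra_power_increment_pos (u := u) (p := p) (u₀ := u₀) hγ (div_pos hA hΓ)
      (Or.inl rfl) ha.1 hab (fun t ht => hpos t (hsub b hb.2 ht)) (hcont.mono (hsub b hb.2))
      fun t ht => by rw [one_mul]; exact heq t (hsub b hb.2 ht)
    linarith
  · have := volterra_power_increment_pos (u := u) (p := p) (u₀ := u₀) hγ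
      (div_pos (neg_pos.2 hA) hΓ) (Or.inr rfl) ha.1 hab (fun t ht => hpos t (hsub b hb.2 ht))
      (hcont.mono (hsub b hb.2))
      fun t ht => by rw [neg_one_mul, neg_div, neg_neg]; exact heq t (hsub b hb.2 ht)
    linarith
end
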